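/- add(σC₀, M) = add(M), where σC₀ is the σ-ideal generated by minimal Cantor sets in the Hilbert cube I^ω and M is the σ-ideal of meager subsets of I^ω. -/

import Mathlib

open Set Topology Cardinal

/-- The Hilbert cube `[0,1]^ℕ` with the product topology. -/
abbrev HilbertCube : Type := ℕ → ↥(Set.Icc (0:ℝ) 1)

/-- An ideal of subsets: a nonempty family closed under subsets and finite unions. -/
def IsIdeal {X : Type*} (I : Set (Set X)) : Prop :=
  I.Nonempty ∧ (∀ A ∈ I, ∀ B, B ⊆ A → B ∈ I) ∧ (∀ A ∈ I, ∀ B ∈ I, A ∪ B ∈ I)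

/-- A σ-ideal: an ideal closed under countable unions. -/
def IsSigmaIdeal {X : Type*} (I : Set (Set X)) : Prop :=
  IsIdeal I ∧ ∀ A : ℕ → Set X, (∀ n, A n ∈ I) → (⋃ n, A n) ∈ I

/-- A non-trivial ideal contains an uncountable set but not the whole space. -/
def NontrivialIdeal {X : Type*} (I : Set (Set X)) : Prop :=
  (∃ A ∈ I, ¬ A.Countable) ∧ Set.univ ∉ I

/-- An ideal on a topological space is topologically invariant if it is preserved by
all homeomorphisms of the space. -/
def TopInvariant {X : Type*} [TopologicalSpace X] (I : Set (Set X)) : Prop :=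
  ∀ h : X ≃ₜ X, {B | ∃ A ∈ I, B = h '' A} = I

/-- `I` has a base all of whose members satisfy `P`. -/
def HasBaseWith {X : Type*} (I : Set (Set X)) (P : Set X → Prop) : Prop :=
  ∃ B ⊆ I, (∀ A ∈ I, ∃ C ∈ B, A ⊆ C) ∧ ∀ C ∈ B, P C

/-- A set has the Baire property if it differs from some open set by a meager set. -/
def HasBaireProperty {X : Type*} [TopologicalSpace X] (A : Set X) : Prop :=
  ∃ U : Set X, IsOpen U ∧ IsMeagre ((A \ U) ∪ (U \ A))

/-- The σ-ideal of meager subsets of a topological space. -/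
def MeagerIdeal (X : Type*) [TopologicalSpace X] : Set (Set X) := {A | IsMeagre A}

/-- The σ-ideal generated by a family `F`: all subsets of countable unions of members
of `F`. -/
def sigmaGenerated {X : Type*} (F : Set (Set X)) : Set (Set X) :=
  {A | ∃ S : ℕ → Set X, (∀ n, S n ∈ F) ∧ A ⊆ ⋃ n, S n}

/-- A Cantor set in the Hilbert cube: a subset homeomorphic to the Cantor cube. -/
def IsCantorSet (C : Set HilbertCube) : Prop := Nonempty (C ≃ₜ (ℕ → Bool))

/-- A minimal Cantor set: one that can be mapped into any other Cantor set by an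
ambient homeomorphism. -/
def IsMinimalCantorSet (A : Set HilbertCube) : Prop :=
  IsCantorSet A ∧ ∀ B : Set HilbertCube, IsCantorSet B →
    ∃ h : HilbertCube ≃ₜ HilbertCube, h '' A ⊆ B

/-- The family of all minimal Cantor sets in the Hilbert cube. -/
def CantorFamily : Set (Set HilbertCube) := {A | IsMinimalCantorSet A}

/-- The σ-ideal generated by minimal Cantor sets. -/
def sigmaC0 : Set (Set HilbertCube) := sigmaGenerated CantorFamily

/-- A minimal dense Gδ-subset of the Hilbert cube. -/
def IsMinimalDenseGdelta (A : Set HilbertCube) : Prop :=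
  IsGδ A ∧ Dense A ∧ ∀ B : Set HilbertCube, IsGδ B → Dense B →
    ∃ h : HilbertCube ≃ₜ HilbertCube, h '' A ⊆ B

/-- The family of all minimal dense Gδ-sets in the Hilbert cube. -/
def GdeltaFamily : Set (Set HilbertCube) := {A | IsMinimalDenseGdelta A}

/-- The σ-ideal generated by minimal dense Gδ-sets. -/
def sigmaG0 : Set (Set HilbertCube) := sigmaGenerated GdeltaFamily

/-- `cov(I)`: the least cardinality of a subfamily of `I` covering the space. -/
noncomputable def covIdeal {X : Type*} (I : Set (Set X)) : Cardinal :=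
  sInf {c | ∃ A : Set (Set X), A ⊆ I ∧ ⋃₀ A = Set.univ ∧ c = #A}

/-- `non(I)`: the least cardinality of a subset of the space not in `I`. -/
noncomputable def nonIdeal {X : Type*} (I : Set (Set X)) : Cardinal :=
  sInf {c | ∃ A : Set X, A ∉ I ∧ c = #A}

/-- `add(I,J)`: the least cardinality of a subfamily of `I` whose union is not in `J`. -/
noncomputable def addIdeal2 {X : Type*} (I J : Set (Set X)) : Cardinal :=
  sInf {c | ∃ A : Set (Set X), A ⊆ I ∧ ⋃₀ A ∉ J ∧ c = #A}

/-- `add(I) = add(I,I)`. -/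
noncomputable def addIdeal {X : Type*} (I : Set (Set X)) : Cardinal := addIdeal2 I I

/-- `cof(I,J)`: the least cardinality of a subfamily of `J` cofinal in `I`. -/
noncomputable def cofIdeal2 {X : Type*} (I J : Set (Set X)) : Cardinal :=
  sInf {c | ∃ A : Set (Set X), A ⊆ J ∧ (∀ B ∈ I, ∃ C ∈ A, B ⊆ C) ∧ c = #A}

/-- `cof(I) = cof(I,I)`. -/
noncomputable def cofIdeal {X : Type*} (I : Set (Set X)) : Cardinal := cofIdeal2 I I

/-- The compact-open topology on the homeomorphism group of a space, induced by the
compact-open topology of the space of continuous self-maps. -/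
noncomputable instance homeoGroupTopology (X : Type*) [TopologicalSpace X] :
    TopologicalSpace (X ≃ₜ X) :=
  TopologicalSpace.induced (fun h : X ≃ₜ X => (⟨h, h.continuous⟩ : C(X, X)))
    ContinuousMap.compactOpen

/-- A Z-set: a closed set `A` such that for every open cover `U` of the space there is a
continuous map into the complement of `A` which is `U`-near to the identity. -/
def IsZSet {X : Type*} [TopologicalSpace X] (A : Set X) : Prop :=
  IsClosed A ∧ ∀ U : Set (Set X), (∀ V ∈ U, IsOpen V) → ⋃₀ U = Set.univ →
    ∃ f : C(X, X), (∀ x, f x ∉ A) ∧ ∀ x : X, ∃ V ∈ U, x ∈ V ∧ f x ∈ V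

/-- A σZ-set: a countable union of Z-sets. -/
def IsSigmaZSet {X : Type*} [TopologicalSpace X] (A : Set X) : Prop :=
  ∃ Z : ℕ → Set X, (∀ n, IsZSet (Z n)) ∧ A = ⋃ n, Z n

/-- The cube `[0,1]^n`. -/
abbrev FinCube (n : ℕ) : Type := Fin n → ↥(Set.Icc (0:ℝ) 1)

/-- A `Z_n`-set in the Hilbert cube: a closed set `A` such that maps avoiding `A` are
dense in the space `C([0,1]^n, I^ω)` with the compact-open topology. -/
def IsZnSet (n : ℕ) (A : Set HilbertCube) : Prop :=
  IsClosed A ∧ Dense {f : C(FinCube n, HilbertCube) | ∀ x, f x ∉ A}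

/-- A `Z_ω`-set in the Hilbert cube: a closed set which is a `Z_n`-set for all `n`. -/
def IsZomegaSet (A : Set HilbertCube) : Prop :=
  IsClosed A ∧ ∀ n : ℕ, IsZnSet n A

/-- Covering dimension of a space is at most `n`: every finite open cover has a finite
open refinement (still a cover) in which no point belongs to more than `n+1` members. -/
def CovDimLE (Y : Type*) [TopologicalSpace Y] (n : ℕ) : Prop :=
  ∀ U : Set (Set Y), U.Finite → (∀ V ∈ U, IsOpen V) → ⋃₀ U = Set.univ →
    ∃ V : Set (Set Y), V.Finite ∧ (∀ W ∈ V, IsOpen W) ∧ ⋃₀ V = Set.univ ∧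
      (∀ W ∈ V, ∃ W' ∈ U, W ⊆ W') ∧
      ∀ y : Y, {W ∈ V | y ∈ W}.ncard ≤ n + 1

/-- A `G_δ`-generated topologically invariant ideal on the Hilbert cube. -/
def GdeltaGenerated (I : Set (Set HilbertCube)) : Prop :=
  HasBaseWith I IsSigmaCompact ∧
  ∃ G : Set HilbertCube, IsGδ G ∧
    (∀ K : Set HilbertCube, K ⊆ G → IsCompact K → K ∈ I) ∧
    ∀ A ∈ I, IsCompact A →
      Dense {h : HilbertCube ≃ₜ HilbertCube | h '' A ⊆ G}

/-- A `G_δ*`-generated ideal: a preimage of a `G_δ`-generated ideal under an embedding. -/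
def GdeltaStarGenerated (I : Set (Set HilbertCube)) : Prop :=
  ∃ I' : Set (Set HilbertCube), GdeltaGenerated I' ∧
    ∃ e : HilbertCube → HilbertCube, IsEmbedding e ∧ I = {S | ∃ A ∈ I', S = e ⁻¹' A}

/-- A `σG_δ*`-generated ideal. -/
def SigmaGdeltaStarGenerated (I : Set (Set HilbertCube)) : Prop :=
  ∃ In : ℕ → Set (Set HilbertCube), (∀ n, GdeltaStarGenerated (In n)) ∧
    (∀ n, In n ⊆ I) ∧
    ∀ A ∈ I, ∃ K : ℕ → Set HilbertCube,
      (∀ n, IsCompact (K n) ∧ K n ∈ In n) ∧ A ⊆ ⋃ n, K n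

/-- The Möbius flow on `[0,1]`: it multiplies the odds `x / (1 - x)` by `exp s`. -/
noncomputable def mob (s : ℝ) (x : Icc (0:ℝ) 1) : Icc (0:ℝ) 1 :=
  ⟨Real.exp s * x / (1 - x + Real.exp s * x), by
    have h0 := x.2.1
    have h1 := x.2.2
    have hs := Real.exp_pos s
    have h2 : 0 ≤ Real.exp s * x := by positivity
    constructor
    · apply div_nonneg h2; linarith
    · apply div_le_one_of_le₀ <;> linarith⟩

lemma mob_den_pos (s : ℝ) (x : Icc (0:ℝ) 1) : 0 < 1 - (x:ℝ) + Real.exp s * x := by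
  have h0 := x.2.1
  have h1 := x.2.2
  have hs := Real.exp_pos s
  rcases h0.eq_or_lt with h | h
  · rw [← h]; norm_num
  · have : 0 < Real.exp s * x := by positivity
    linarith

lemma continuous_mob : Continuous fun p : ℝ × Icc (0:ℝ) 1 => mob p.1 p.2 := by
  refine Continuous.subtype_mk (Continuous.div ?_ ?_ fun p : ℝ × Icc (0:ℝ) 1 => (mob_den_pos p.1 p.2).ne') _ <;>
    fun_prop

lemma mob_neg_mob (s : ℝ) (x : Icc (0:ℝ) 1) : mob (-s) (mob s x) = x := by
  have h := mob_den_pos s x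
  have hs := Real.exp_pos s
  have hd : 1 - Real.exp s * x / (1 - x + Real.exp s * x) +
      Real.exp (-s) * (Real.exp s * x / (1 - x + Real.exp s * x)) =
      1 / (1 - x + Real.exp s * x) := by
    rw [Real.exp_neg]; field_simp; ring
  apply Subtype.ext
  change Real.exp (-s) * (Real.exp s * x / (1 - x + Real.exp s * x)) / (1 - Real.exp s * x / (1 - x + Real.exp s * x) +
      Real.exp (-s) * (Real.exp s * x / (1 - x + Real.exp s * x))) = x
  rw [hd, Real.exp_neg]
  field_simp

lemma mob_mob_neg (s : ℝ) (x : Icc (0:ℝ) 1) : mob s (mob (-s) x) = x := by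
  simpa using mob_neg_mob (-s) x

/-- The logarithm of the odds of a point of `[0,1]`. -/
noncomputable def logOdds (x : Icc (0:ℝ) 1) : ℝ := Real.log (x / (1 - x))

/-- The open unit interval inside `[0,1]`. -/
def innerIcc : Set (Icc (0:ℝ) 1) := {x | 0 < (x:ℝ) ∧ (x:ℝ) < 1}

lemma isOpen_innerIcc : IsOpen innerIcc :=
  (isOpen_lt continuous_const continuous_subtype_val).inter
    (isOpen_lt continuous_subtype_val continuous_const)

lemma mob_mem_inner {s : ℝ} {x : Icc (0:ℝ) 1} (hx : x ∈ innerIcc) : mob s x ∈ innerIcc := by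
  have h := mob_den_pos s x
  have hs := Real.exp_pos s
  obtain ⟨h0, h1⟩ := hx
  refine ⟨div_pos (by positivity) h, ?_⟩
  change Real.exp s * x / (1 - x + Real.exp s * x) < 1
  rw [div_lt_one h]; linarith

lemma logOdds_mob {s : ℝ} {x : Icc (0:ℝ) 1} (hx : x ∈ innerIcc) :
    logOdds (mob s x) = s + logOdds x := by
  have h := mob_den_pos s x
  have hs := Real.exp_pos s
  obtain ⟨h0, h1⟩ := hx
  have h1' : (0:ℝ) < 1 - x := by linarith
  have : Real.exp s * x / (1 - x + Real.exp s * x) /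
      (1 - Real.exp s * x / (1 - x + Real.exp s * x)) = Real.exp s * (x / (1 - x)) := by
    have : 1 - Real.exp s * x / (1 - x + Real.exp s * x) = (1 - x) / (1 - x + Real.exp s * x) := by
      field_simp; ring
    rw [this]; field_simp
  unfold logOdds
  change Real.log (Real.exp s * x / (1 - x + Real.exp s * x) /
      (1 - Real.exp s * x / (1 - x + Real.exp s * x))) = _
  rw [this, Real.log_mul hs.ne' (by positivity), Real.log_exp]

lemma logOdds_injOn : InjOn logOdds innerIcc := by
  intro x hx y hy h
  have hx1 : (0:ℝ) < 1 - x := by linarith [hx.2]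
  have hy1 : (0:ℝ) < 1 - y := by linarith [hy.2]
  have := Real.log_injOn_pos (div_pos hx.1 hx1) (div_pos hy.1 hy1) h
  rw [div_eq_div_iff hx1.ne' hy1.ne'] at this
  apply Subtype.ext
  linarith

lemma continuousOn_logOdds : ContinuousOn logOdds innerIcc := by
  refine ContinuousOn.log (ContinuousOn.div ?_ ?_ ?_) ?_
  · fun_prop
  · fun_prop
  · intro x hx; have := hx.2; linarith
  · intro x hx
    have := hx.1
    have : (0:ℝ) < 1 - x := by linarith [hx.2]
    positivity

lemma mob_logOdds_sub {x y : Icc (0:ℝ) 1} (hx : x ∈ innerIcc) (hy : y ∈ innerIcc) :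
    mob (logOdds y - logOdds x) x = y :=
  logOdds_injOn (mob_mem_inner hx) hy (by rw [logOdds_mob hx]; ring)

/-- The midpoint of `[0,1]`. -/
noncomputable def midIcc : Icc (0:ℝ) 1 := ⟨1 / 2, by norm_num, by norm_num⟩

lemma midIcc_mem_inner : midIcc ∈ innerIcc := by
  constructor <;> simp only [midIcc] <;> norm_num

section Shear

open Classical in
/-- The homeomorphism of the Hilbert cube which moves the coordinates outside `J` along the
Möbius flow, for times depending on the coordinates in `J`. -/
noncomputable def shear (J : Set ℕ) (s : ℕ → C(J → Icc (0:ℝ) 1, ℝ)) :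
    HilbertCube ≃ₜ HilbertCube where
  toFun x k := if k ∈ J then x k else mob (s k (J.domRestrict x)) (x k)
  invFun x k := if k ∈ J then x k else mob (-s k (J.domRestrict x)) (x k)
  left_inv x := by
    have : J.domRestrict (fun k => if k ∈ J then x k else mob (s k (J.domRestrict x)) (x k)) =
        J.domRestrict x := by
      ext k; simp [domRestrict]
    funext k
    by_cases hk : k ∈ J
    · simp [hk]
    · simp only [this, hk, if_false]
      exact mob_neg_mob _ _
  right_inv x := by
    have : J.domRestrict (fun k => if k ∈ J then x k else mob (-s k (J.domRestrict x)) (x k)) =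
        J.domRestrict x := by
      ext k; simp [domRestrict]
    funext k
    by_cases hk : k ∈ J
    · simp [hk]
    · simp only [this, hk, if_false]
      exact mob_mob_neg _ _
  continuous_toFun := by
    refine continuous_pi fun k => ?_
    by_cases hk : k ∈ J
    · simp only [hk, if_true]; fun_prop
    · simp only [hk, if_false]
      have : Continuous fun x : HilbertCube => J.domRestrict x :=
        continuous_pi fun k => continuous_apply _
      exact continuous_mob.comp
        (((s k).continuous.comp this).prodMk (continuous_apply k))
  continuous_invFun := by
    refine continuous_pi fun k => ?_
    by_cases hk : k ∈ J
    · simp only [hk, if_true]; fun_prop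
    · simp only [hk, if_false]
      have : Continuous fun x : HilbertCube => J.domRestrict x :=
        continuous_pi fun k => continuous_apply _
      exact continuous_mob.comp
        (((s k).continuous.comp this).neg.prodMk (continuous_apply k))

lemma shear_apply_mem {J : Set ℕ} (s : ℕ → C(J → Icc (0:ℝ) 1, ℝ)) (x : HilbertCube) {k : ℕ}
    (hk : k ∈ J) : shear J s x k = x k := if_pos hk

lemma shear_apply_notMem {J : Set ℕ} (s : ℕ → C(J → Icc (0:ℝ) 1, ℝ)) (x : HilbertCube) {k : ℕ}
    (hk : k ∉ J) : shear J s x k = mob (s k (J.domRestrict x)) (x k) := if_neg hk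

variable {X : Type*} [TopologicalSpace X] [CompactSpace X]

/-- If the coordinates in `J` determine the points of a compact set, then the remaining
coordinates can be prescribed by an ambient homeomorphism, within the open unit interval. -/
lemma exists_homeo_prescribe {a : X → HilbertCube} (ha : Continuous a) (J : Set ℕ)
    (hJ : Function.Injective fun x => J.domRestrict (a x))
    (hai : ∀ x, ∀ k ∉ J, a x k ∈ innerIcc) {t : X → HilbertCube} (ht : Continuous t)
    (hti : ∀ x, ∀ k ∉ J, t x k ∈ innerIcc) :
    ∃ g : HilbertCube ≃ₜ HilbertCube, ∀ x, (∀ k ∈ J, g (a x) k = a x k) ∧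
      ∀ k ∉ J, g (a x) k = t x k := by
  have hemb : IsClosedEmbedding fun x => J.domRestrict (a x) :=
    Continuous.isClosedEmbedding
      (continuous_pi fun k => (continuous_apply (k:ℕ)).comp ha) hJ
  have key : ∀ k, ∃ s : C(J → Icc (0:ℝ) 1, ℝ), k ∉ J →
      ∀ x, s (J.domRestrict (a x)) = logOdds (t x k) - logOdds (a x k) := by
    intro k
    by_cases hk : k ∈ J
    · exact ⟨0, fun h => absurd hk h⟩
    have hc : Continuous fun x => logOdds (t x k) - logOdds (a x k) := by
      apply Continuous.sub
      · exact continuousOn_logOdds.comp_continuous ((continuous_apply k).comp ht)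
          fun x => hti x k hk
      · exact continuousOn_logOdds.comp_continuous ((continuous_apply k).comp ha)
          fun x => hai x k hk
    obtain ⟨s, hs⟩ := ContinuousMap.exists_extension hemb ⟨_, hc⟩
    exact ⟨s, fun _ x => DFunLike.congr_fun hs x⟩
  choose s hs using key
  refine ⟨shear J s, fun x => ⟨fun k hk => shear_apply_mem _ _ hk, fun k hk => ?_⟩⟩
  rw [shear_apply_notMem _ _ hk, hs k hk x, mob_logOdds_sub (hai x k hk) (hti x k hk)]

/-- A compact subset of the pseudo-interior can be moved, inside the pseudo-interior, so that
the coordinate `0` is determined by the others. -/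
lemma exists_homeo_injective_tail {a : X → HilbertCube} (ha : Continuous a)
    (hinj : Function.Injective a) (hai : ∀ x k, a x k ∈ innerIcc) :
    ∃ g : HilbertCube ≃ₜ HilbertCube, (∀ x k, g (a x) k ∈ innerIcc) ∧
      Function.Injective fun x => ({0}ᶜ : Set ℕ).domRestrict (g (a x)) := by
  have hb : ∀ k, ∃ C : ℝ, ∀ x, |logOdds (a x k)| ≤ C := by
    intro k
    have hc : Continuous fun x => logOdds (a x k) :=
      continuousOn_logOdds.comp_continuous ((continuous_apply k).comp ha) fun x => hai x k
    obtain ⟨C, hC⟩ := (isCompact_range hc).isBounded.exists_norm_le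
    exact ⟨C, fun x => hC _ ⟨x, rfl⟩⟩
  choose C hC using hb
  let s : ℕ → C(({0} : Set ℕ) → Icc (0:ℝ) 1, ℝ) := fun k =>
    ⟨fun y => k * (2 * |C k| + 1) * y ⟨0, rfl⟩, by fun_prop⟩
  have hval : ∀ x, ∀ k ≠ 0, shear {0} s (a x) k =
      mob (k * (2 * |C k| + 1) * a x 0) (a x k) := fun x k hk =>
    shear_apply_notMem s (a x) (by simpa using hk)
  refine ⟨shear {0} s, fun x k => ?_, fun x y hxy => ?_⟩
  · by_cases hk : k = 0
    · rw [shear_apply_mem s _ (by simpa using hk)]; exact hai x k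
    · rw [hval x k hk]; exact mob_mem_inner (hai x k)
  have hk : ∀ k ≠ 0, mob (k * (2 * |C k| + 1) * a x 0) (a x k) =
      mob (k * (2 * |C k| + 1) * a y 0) (a y k) := by
    intro k hk
    rw [← hval x k hk, ← hval y k hk]
    exact congrFun hxy ⟨k, by simpa using hk⟩
  have h0 : (a x 0 : ℝ) = a y 0 := by
    by_contra hne
    have hpos : 0 < |(a x 0 : ℝ) - a y 0| := abs_pos.2 (sub_ne_zero.2 hne)
    obtain ⟨k, hk1⟩ := exists_nat_gt (1 / |(a x 0 : ℝ) - a y 0|)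
    have hkpos : (0:ℝ) < k := lt_trans (by positivity) hk1
    have hk0 : k ≠ 0 := by rintro rfl; simp at hkpos
    have h := congrArg logOdds (hk k hk0)
    rw [logOdds_mob (hai x k), logOdds_mob (hai y k)] at h
    have h2 : |(k * (2 * |C k| + 1)) * ((a x 0 : ℝ) - a y 0)| ≤ 2 * |C k| := by
      have : (k * (2 * |C k| + 1)) * ((a x 0 : ℝ) - a y 0) =
        logOdds (a y k) - logOdds (a x k) := by linarith
      rw [this]
      refine (abs_sub _ _).trans ?_
      have := hC k x
      have := hC k y
      have := le_abs_self (C k)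
      linarith
    rw [abs_mul, abs_of_nonneg (by positivity)] at h2
    rw [div_lt_iff₀ hpos] at hk1
    nlinarith [abs_nonneg (C k)]
  apply hinj
  funext k
  by_cases hk0 : k = 0
  · subst hk0; exact Subtype.ext h0
  · have := hk k hk0
    rw [h0] at this
    have := congrArg (mob (-(k * (2 * |C k| + 1) * a y 0))) this
    rwa [mob_neg_mob, mob_neg_mob] at this

end Shear

/-- The standard embedding of the real line in the Hilbert cube, along the coordinate `0`. -/
noncomputable def stdLine (t : ℝ) : HilbertCube := fun k => if k = 0 then mob t midIcc else midIcc

lemma continuous_stdLine : Continuous stdLine := by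
  refine continuous_pi fun k => ?_
  by_cases hk : k = 0
  · simp only [stdLine, hk, if_true]
    exact continuous_mob.comp (by fun_prop : Continuous fun t : ℝ => (t, midIcc))
  · simp only [stdLine, hk, if_false]; fun_prop

lemma stdLine_mem_inner (t : ℝ) (k : ℕ) : stdLine t k ∈ innerIcc := by
  unfold stdLine
  split_ifs
  exacts [mob_mem_inner midIcc_mem_inner, midIcc_mem_inner]

lemma stdLine_apply_zero_injective : Function.Injective fun t => stdLine t 0 := by
  intro s t h
  have h : mob s midIcc = mob t midIcc := h
  have := congrArg logOdds h
  rwa [logOdds_mob midIcc_mem_inner, logOdds_mob midIcc_mem_inner, add_left_inj] at this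

/-- Compact subsets of the pseudo-interior are straightened by ambient homeomorphisms. -/
lemma exists_homeo_stdLine {X : Type*} [TopologicalSpace X] [CompactSpace X]
    {a : X → HilbertCube} (ha : Continuous a)
    (hinj : Function.Injective a) (hai : ∀ x k, a x k ∈ innerIcc) {e : X → ℝ} (he : Continuous e)
    (heinj : Function.Injective e) :
    ∃ g : HilbertCube ≃ₜ HilbertCube, ∀ x, g (a x) = stdLine (e x) := by
  have ht : Continuous fun x => stdLine (e x) := continuous_stdLine.comp he
  obtain ⟨g₁, hg₁, hg₁'⟩ := exists_homeo_injective_tail ha hinj hai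
  obtain ⟨g₂, hg₂⟩ := exists_homeo_prescribe (g₁.continuous.comp ha) {0}ᶜ hg₁'
    (fun x k _ => hg₁ x k) ht (fun x k _ => stdLine_mem_inner _ _)
  have h0 : ∀ x, g₂ (g₁ (a x)) 0 = stdLine (e x) 0 := fun x => (hg₂ x).2 0 (by simp)
  obtain ⟨g₃, hg₃⟩ := exists_homeo_prescribe (g₂.continuous.comp (g₁.continuous.comp ha)) {0}
    (fun x y hxy => heinj <| stdLine_apply_zero_injective <| by
      have := congrFun hxy ⟨0, rfl⟩
      simpa [domRestrict, h0] using this)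
    (fun x k hk => by
      change g₂ (g₁ (a x)) k ∈ _
      rw [show g₂ (g₁ (a x)) k = g₁ (a x) k from (hg₂ x).1 k hk]; exact hg₁ x k) ht
    (fun x k _ => stdLine_mem_inner _ _)
  refine ⟨(g₁.trans g₂).trans g₃, fun x => funext fun k => ?_⟩
  by_cases hk : k ∈ ({0} : Set ℕ)
  · rw [mem_singleton_iff.1 hk]
    exact ((hg₃ x).1 0 rfl).trans (h0 x)
  · exact (hg₃ x).2 k hk

/-- The scaling factor of the homeomorphism `squeeze l` of the square `[-1,1]²`. -/
noncomputable def squeezeFactor (l : ℝ) (p : ℝ × ℝ) : ℝ :=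
  max |p.1| |p.2| / max |p.1| (l * |p.2|)

/-- The self-homeomorphism of the square `[-1,1]²`, preserving the supremum norm, which for
`1 < l` pushes parts of the vertical sides to the horizontal ones. -/
noncomputable def squeeze (l : ℝ) (p : ℝ × ℝ) : ℝ × ℝ :=
  (squeezeFactor l p * p.1, squeezeFactor l p * (l * p.2))

lemma squeeze_den_pos {l : ℝ} (hl : 0 < l) {p : ℝ × ℝ} (hp : p ≠ 0) :
    0 < max |p.1| (l * |p.2|) := by
  by_contra! h
  have h1 := (le_max_left _ _).trans h
  have h2 := (le_max_right _ _).trans h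
  apply hp
  have h3 : |p.2| ≤ 0 := nonpos_of_mul_nonpos_right h2 hl
  ext
  · simpa using h1
  · simpa using h3

lemma squeezeFactor_nonneg {l : ℝ} (p : ℝ × ℝ) : 0 ≤ squeezeFactor l p :=
  div_nonneg (le_max_of_le_left (abs_nonneg _)) (le_max_of_le_left (abs_nonneg _))

lemma squeezeFactor_mul {l : ℝ} (hl : 0 < l) (p : ℝ × ℝ) :
    squeezeFactor l p * max |p.1| (l * |p.2|) = max |p.1| |p.2| := by
  by_cases hp : p = 0
  · simp [hp]
  · exact div_mul_cancel₀ _ (squeeze_den_pos hl hp).ne'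

lemma max_abs_squeeze {l : ℝ} (hl : 0 < l) (p : ℝ × ℝ) :
    max |(squeeze l p).1| |(squeeze l p).2| = max |p.1| |p.2| := by
  have h := squeezeFactor_nonneg (l := l) p
  simp only [squeeze, abs_mul, abs_of_nonneg h, abs_of_pos hl]
  rw [← mul_max_of_nonneg _ _ h, squeezeFactor_mul hl]

lemma squeeze_inv_squeeze {l : ℝ} (hl : 0 < l) (p : ℝ × ℝ) : squeeze l⁻¹ (squeeze l p) = p := by
  by_cases hp : p = 0
  · simp [hp, squeeze]
  have hd := squeeze_den_pos hl hp
  have hn : 0 < max |p.1| |p.2| := by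
    simpa using squeeze_den_pos one_pos hp
  have hr : 0 < squeezeFactor l p := div_pos hn hd
  have key : squeezeFactor l⁻¹ (squeeze l p) = (squeezeFactor l p)⁻¹ := by
    rw [squeezeFactor, max_abs_squeeze hl]
    simp only [squeeze, abs_mul, abs_of_pos hr, abs_of_pos hl]
    rw [show l⁻¹ * (squeezeFactor l p * (l * |p.2|)) = squeezeFactor l p * |p.2| by field_simp,
      ← mul_max_of_nonneg _ _ hr.le]
    field_simp
  rw [squeeze, key]
  ext <;> simp only [squeeze] <;> field_simp

lemma squeeze_squeeze_inv {l : ℝ} (hl : 0 < l) (p : ℝ × ℝ) : squeeze l (squeeze l⁻¹ p) = p := by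
  simpa using squeeze_inv_squeeze (inv_pos.2 hl) p

lemma continuous_squeeze {l : ℝ} (hl : 0 < l) : Continuous (squeeze l) := by
  rw [continuous_iff_continuousAt]
  intro p
  by_cases hp : p = 0
  · subst hp
    have h0 : squeeze l 0 = 0 := by simp [squeeze]
    rw [ContinuousAt, h0]
    refine squeeze_zero_norm (a := fun p => ‖p‖) (fun p => ?_) ?_
    · have := max_abs_squeeze hl p
      simp only [Prod.norm_def, Real.norm_eq_abs]
      exact this.le
    · simpa using (continuous_norm (E := ℝ × ℝ)).tendsto 0
  · have : ContinuousAt (squeezeFactor l) p := by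
      unfold squeezeFactor
      refine ContinuousAt.div ?_ ?_ (squeeze_den_pos hl hp).ne' <;> fun_prop
    unfold squeeze
    fun_prop

lemma abs_squeeze_fst_sub_le {l : ℝ} (hl : 0 < l) (p : ℝ × ℝ) :
    |(squeeze l p).1 - p.1| ≤ |l - 1| * |p.2| := by
  by_cases hp : p = 0
  · simp [hp, squeeze]
  have hd := squeeze_den_pos hl hp
  have h1 : (squeeze l p).1 - p.1 =
      (max |p.1| |p.2| - max |p.1| (l * |p.2|)) * (p.1 / max |p.1| (l * |p.2|)) := by
    simp only [squeeze, squeezeFactor]; field_simp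
  have h2 : |p.1 / max |p.1| (l * |p.2|)| ≤ 1 := by
    rw [abs_div, abs_of_pos hd]
    exact div_le_one_of_le₀ (le_max_left _ _) hd.le
  have h3 : |max |p.1| |p.2| - max |p.1| (l * |p.2|)| ≤ |l - 1| * |p.2| := by
    have := abs_max_sub_max_le_max |p.1| |p.2| |p.1| (l * |p.2|)
    rw [sub_self, abs_zero, max_eq_right (a := (0:ℝ)) (abs_nonneg _)] at this
    refine this.trans (le_of_eq ?_)
    rw [show |p.2| - l * |p.2| = (1 - l) * |p.2| by ring, abs_mul, abs_abs, abs_sub_comm]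
  rw [h1, abs_mul]
  calc _ ≤ |max |p.1| |p.2| - max |p.1| (l * |p.2|)| * 1 := by gcongr
    _ ≤ _ := by rwa [mul_one]

lemma abs_squeeze_fst_lt {l : ℝ} {p : ℝ × ℝ} (h1 : |p.1| ≤ 1) (h2 : |p.2| ≤ 1)
    (h3 : 1 < l * |p.2|) : |(squeeze l p).1| < 1 := by
  have hd : 1 < max |p.1| (l * |p.2|) := lt_max_of_lt_right h3
  have hn : max |p.1| |p.2| ≤ 1 := max_le h1 h2
  have hr : squeezeFactor l p < 1 := by
    rw [squeezeFactor, div_lt_one (by linarith)]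
    linarith
  simp only [squeeze]
  rw [abs_mul, abs_of_nonneg (squeezeFactor_nonneg p)]
  have := squeezeFactor_nonneg (l := l) p
  nlinarith [abs_nonneg p.1]

/-- The map `squeeze l`, transported to the unit square. -/
noncomputable def unitSqueezeFun (l : ℝ) (hl : 0 < l) (p : Icc (0:ℝ) 1 × Icc (0:ℝ) 1) :
    Icc (0:ℝ) 1 × Icc (0:ℝ) 1 :=
  have h : max |(squeeze l (2 * p.1 - 1, 2 * p.2 - 1)).1|
      |(squeeze l (2 * p.1 - 1, 2 * p.2 - 1)).2| ≤ 1 := by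
    rw [max_abs_squeeze hl]
    exact max_le (abs_le.2 ⟨by linarith [p.1.2.1], by linarith [p.1.2.2]⟩)
      (abs_le.2 ⟨by linarith [p.2.2.1], by linarith [p.2.2.2]⟩)
  (⟨((squeeze l (2 * p.1 - 1, 2 * p.2 - 1)).1 + 1) / 2, by
      have := abs_le.1 ((le_max_left _ _).trans h)
      constructor <;> linarith⟩,
    ⟨((squeeze l (2 * p.1 - 1, 2 * p.2 - 1)).2 + 1) / 2, by
      have := abs_le.1 ((le_max_right _ _).trans h)
      constructor <;> linarith⟩)

lemma continuous_unitSqueezeFun (l : ℝ) (hl : 0 < l) : Continuous (unitSqueezeFun l hl) := by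
  have h : Continuous fun p : Icc (0:ℝ) 1 × Icc (0:ℝ) 1 =>
      squeeze l (2 * (p.1:ℝ) - 1, 2 * (p.2:ℝ) - 1) :=
    (continuous_squeeze hl).comp (by fun_prop)
  exact (((h.fst.add continuous_const).div_const 2).subtype_mk _).prodMk
    (((h.snd.add continuous_const).div_const 2).subtype_mk _)

lemma unitSqueezeFun_leftInverse {l m : ℝ} (hl : 0 < l) (hm : 0 < m)
    (h : ∀ p, squeeze m (squeeze l p) = p) :
    Function.LeftInverse (unitSqueezeFun m hm) (unitSqueezeFun l hl) := by
  intro p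
  have h2 : (2 * (((unitSqueezeFun l hl p).1 : Icc (0:ℝ) 1) : ℝ) - 1,
      2 * (((unitSqueezeFun l hl p).2 : Icc (0:ℝ) 1) : ℝ) - 1) =
      squeeze l (2 * p.1 - 1, 2 * p.2 - 1) := by
    ext <;> simp only [unitSqueezeFun] <;> ring
  have h3 := h (2 * p.1 - 1, 2 * p.2 - 1)
  rw [← h2] at h3
  apply Prod.ext <;> apply Subtype.ext
  · change ((squeeze m _).1 + 1) / 2 = _
    rw [h3]; ring
  · change ((squeeze m _).2 + 1) / 2 = _
    rw [h3]; ring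

/-- The homeomorphism `squeeze l`, transported to the unit square. -/
noncomputable def unitSqueeze (l : ℝ) (hl : 0 < l) :
    Icc (0:ℝ) 1 × Icc (0:ℝ) 1 ≃ₜ Icc (0:ℝ) 1 × Icc (0:ℝ) 1 where
  toFun := unitSqueezeFun l hl
  invFun := unitSqueezeFun l⁻¹ (inv_pos.2 hl)
  left_inv := unitSqueezeFun_leftInverse _ _ (squeeze_inv_squeeze hl)
  right_inv := unitSqueezeFun_leftInverse _ _ (squeeze_squeeze_inv hl)
  continuous_toFun := continuous_unitSqueezeFun _ _
  continuous_invFun := continuous_unitSqueezeFun _ _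

lemma dist_unitSqueezeFun_fst_le {l : ℝ} (hl : 0 < l) (p : Icc (0:ℝ) 1 × Icc (0:ℝ) 1) :
    dist (unitSqueezeFun l hl p).1 p.1 ≤ |l - 1| := by
  have h := abs_squeeze_fst_sub_le hl (2 * (p.1:ℝ) - 1, 2 * (p.2:ℝ) - 1)
  rw [Subtype.dist_eq, Real.dist_eq]
  have h2 : ((unitSqueezeFun l hl p).1 : ℝ) - p.1 =
      ((squeeze l (2 * (p.1:ℝ) - 1, 2 * (p.2:ℝ) - 1)).1 - (2 * p.1 - 1)) / 2 := by
    simp only [unitSqueezeFun]; ring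
  have h3 : |2 * (p.2:ℝ) - 1| ≤ 1 :=
    abs_le.2 ⟨by linarith [p.2.2.1], by linarith [p.2.2.2]⟩
  rw [h2, abs_div, abs_two]
  simp only at h
  nlinarith [abs_nonneg (l - 1)]

/-- A homeomorphism of `[0,1]` blowing up the interval `(c, d)` to almost everything. -/
lemma exists_homeo_blowup {c d : Icc (0:ℝ) 1} (hcd : c < d) {ε : ℝ} (hε : 0 < ε) (hε1 : ε < 1) :
    ∃ ψ : Icc (0:ℝ) 1 ≃ₜ Icc (0:ℝ) 1, ∀ y, (y ≤ c → (ψ y : ℝ) ≤ ε) ∧ (d ≤ y → 1 - ε ≤ (ψ y : ℝ)) := by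
  have hcd' : (0:ℝ) < d - c := sub_pos.2 hcd
  let r : Icc (0:ℝ) 1 → ℝ := fun y => max 0 (min 1 (((y:ℝ) - c) / (d - c)))
  have hr0 : ∀ y, 0 ≤ r y := fun y => le_max_left _ _
  have hr1 : ∀ y, r y ≤ 1 := fun y => max_le zero_le_one (min_le_left _ _)
  have hrm : Monotone r := by
    intro y z hyz
    have : (y:ℝ) ≤ z := hyz
    simp only [r]
    gcongr
  have hrc : ∀ y ≤ c, r y = 0 := by
    intro y hy
    have : (y:ℝ) - c ≤ 0 := sub_nonpos.2 hy
    exact max_eq_left ((min_le_right _ _).trans (div_nonpos_of_nonpos_of_nonneg this hcd'.le))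
  have hrd : ∀ y, d ≤ y → r y = 1 := by
    intro y hy
    have h1 : (d:ℝ) ≤ y := hy
    have : 1 ≤ ((y:ℝ) - c) / (d - c) := by rw [le_div_iff₀ hcd']; linarith
    simp [r, min_eq_left this]
  let f : Icc (0:ℝ) 1 → Icc (0:ℝ) 1 := fun y => ⟨ε * y + (1 - ε) * r y, by
    have h1 := hr0 y
    have h2 := hr1 y
    have h3 := y.2.1
    have h4 := y.2.2
    constructor
    · have : 0 ≤ 1 - ε := by linarith
      positivity
    · nlinarith⟩
  have hfc : Continuous f := Continuous.subtype_mk (by fun_prop) _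
  have hfm : StrictMono f := by
    intro y z hyz
    have h1 : (y:ℝ) < z := hyz
    have h2 := hrm hyz.le
    change ε * (y:ℝ) + (1 - ε) * r y < ε * z + (1 - ε) * r z
    nlinarith
  have h0 : f 0 = 0 := by
    apply Subtype.ext
    change ε * ((0 : Icc (0:ℝ) 1) : ℝ) + (1 - ε) * r 0 = 0
    rw [hrc 0 c.2.1]; simp
  have h1 : f 1 = 1 := by
    apply Subtype.ext
    change ε * ((1 : Icc (0:ℝ) 1) : ℝ) + (1 - ε) * r 1 = 1
    rw [hrd 1 d.2.2]; simp
  have hsurj : Function.Surjective f := fun y =>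
    mem_range_of_exists_le_of_exists_ge hfc ⟨0, h0.trans_le y.2.1⟩ ⟨1, h1.ge.trans' y.2.2⟩
  refine ⟨Continuous.homeoOfEquivCompactToT2 (f := Equiv.ofBijective f ⟨hfm.injective, hsurj⟩) hfc,
    fun y => ⟨fun hy => ?_, fun hy => ?_⟩⟩
  · change ε * (y:ℝ) + (1 - ε) * r y ≤ ε
    rw [hrc y hy]
    nlinarith [y.2.2]
  · change 1 - ε ≤ ε * (y:ℝ) + (1 - ε) * r y
    rw [hrd y hy]
    nlinarith [y.2.1]

/-- A homeomorphism of the square, moving the first coordinate little, which moves the vertical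
sides inside, with the exception of the part of height in `(c, d)`. -/
lemma exists_homeo_square {c d : Icc (0:ℝ) 1} (hcd : c < d) {δ : ℝ} (hδ : 0 < δ) :
    ∃ φ : Icc (0:ℝ) 1 × Icc (0:ℝ) 1 ≃ₜ Icc (0:ℝ) 1 × Icc (0:ℝ) 1,
      (∀ p, dist (φ p).1 p.1 ≤ δ) ∧ (∀ p, dist (φ.symm p).1 p.1 ≤ δ) ∧
      ∀ p, p.2 ∉ Ioo c d → (φ p).1 ∈ innerIcc := by
  have hl : 0 < 1 + δ := by linarith
  have hε1 : δ / (4 * (1 + δ)) < 1 := by rw [div_lt_one (by positivity)]; linarith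
  obtain ⟨ψ, hψ⟩ := exists_homeo_blowup hcd (ε := δ / (4 * (1 + δ))) (by positivity) hε1
  refine ⟨((Homeomorph.refl _).prodCongr ψ).trans (unitSqueeze (1 + δ) hl), fun p => ?_,
    fun p => ?_, fun p hp => ?_⟩
  · refine (dist_unitSqueezeFun_fst_le hl (p.1, ψ p.2)).trans ?_
    rw [add_sub_cancel_left, abs_of_pos hδ]
  · refine (dist_unitSqueezeFun_fst_le (inv_pos.2 hl) p).trans ?_
    rw [show (1 + δ)⁻¹ - 1 = -(δ / (1 + δ)) by field_simp; ring, abs_neg, abs_of_pos (by positivity)]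
    exact div_le_self hδ.le (by linarith)
  · have hlt : 1 < (1 + δ) * (1 - 2 * (δ / (4 * (1 + δ)))) := by
      have : (1 + δ) * (1 - 2 * (δ / (4 * (1 + δ)))) = 1 + δ / 2 := by field_simp; ring
      linarith
    have hY : 1 - 2 * (δ / (4 * (1 + δ))) ≤ |2 * (ψ p.2 : ℝ) - 1| := by
      rcases le_or_gt p.2 c with h | h
      · have := (hψ p.2).1 h
        exact le_abs.2 (Or.inr (by linarith))
      · have := (hψ p.2).2 (not_lt.1 fun h' => hp ⟨h, h'⟩)
        exact le_abs.2 (Or.inl (by linarith))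
    have h := abs_lt.1 (abs_squeeze_fst_lt (p := (2 * (p.1:ℝ) - 1, 2 * (ψ p.2:ℝ) - 1))
      (abs_le.2 ⟨by linarith [p.1.2.1], by linarith [p.1.2.2]⟩)
      (abs_le.2 ⟨by linarith [(ψ p.2).2.1], by linarith [(ψ p.2).2.2]⟩)
      (hlt.trans_le (by gcongr)))
    constructor
    · change 0 < ((squeeze (1 + δ) (2 * (p.1:ℝ) - 1, 2 * (ψ p.2:ℝ) - 1)).1 + 1) / 2
      linarith
    · change ((squeeze (1 + δ) (2 * (p.1:ℝ) - 1, 2 * (ψ p.2:ℝ) - 1)).1 + 1) / 2 < 1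
      linarith

/-- The homeomorphism of the Hilbert cube acting on the coordinates `n` and `m` by a given
homeomorphism of the square. -/
def twist {n m : ℕ} (hnm : n ≠ m)
    (φ : Icc (0:ℝ) 1 × Icc (0:ℝ) 1 ≃ₜ Icc (0:ℝ) 1 × Icc (0:ℝ) 1) :
    HilbertCube ≃ₜ HilbertCube where
  toFun x := Function.update (Function.update x n (φ (x n, x m)).1) m (φ (x n, x m)).2
  invFun x := Function.update (Function.update x n (φ.symm (x n, x m)).1) m (φ.symm (x n, x m)).2
  left_inv x := by
    funext k
    by_cases hm : k = m
    · subst hm; simp [hnm]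
    by_cases hn : k = n
    · subst hn; simp [hnm]
    simp [hm, hn]
  right_inv x := by
    funext k
    by_cases hm : k = m
    · subst hm; simp [hnm]
    by_cases hn : k = n
    · subst hn; simp [hnm]
    simp [hm, hn]
  continuous_toFun := by fun_prop
  continuous_invFun := by fun_prop

section Twist

variable {n m : ℕ} (hnm : n ≠ m)
  (φ : Icc (0:ℝ) 1 × Icc (0:ℝ) 1 ≃ₜ Icc (0:ℝ) 1 × Icc (0:ℝ) 1) (x : HilbertCube)

lemma twist_apply_left : twist hnm φ x n = (φ (x n, x m)).1 := by simp [twist, hnm]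

lemma twist_symm_apply_left : (twist hnm φ).symm x n = (φ.symm (x n, x m)).1 := by
  change Function.update (Function.update x n (φ.symm (x n, x m)).1) m (φ.symm (x n, x m)).2 n = _
  simp [hnm]

lemma twist_apply_of_ne {k : ℕ} (hn : k ≠ n) (hm : k ≠ m) : twist hnm φ x k = x k := by
  simp [twist, hn, hm]

lemma twist_symm_apply_of_ne {k : ℕ} (hn : k ≠ n) (hm : k ≠ m) :
    (twist hnm φ).symm x k = x k := by
  change Function.update (Function.update x n (φ.symm (x n, x m)).1) m (φ.symm (x n, x m)).2 k = _
  simp [hn, hm]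

end Twist

open Filter in
lemma tendsto_hilbertCube_id {u : ℕ → C(HilbertCube, HilbertCube)} {n : ℕ} {δ : ℕ → ℝ}
    (hδ : Tendsto δ atTop (𝓝 0)) (hn : ∀ j x, dist (u j x n) (x n) ≤ δ j)
    (hk : ∀ k ≠ n, ∀ᶠ j in atTop, ∀ x, u j x k = x k) :
    Tendsto u atTop (𝓝 (ContinuousMap.id HilbertCube)) := by
  rw [ContinuousMap.tendsto_iff_tendstoUniformly, tendstoUniformly_iff_tendsto, Pi.uniformity,
    tendsto_iInf]
  intro k
  rw [tendsto_comap_iff]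
  have : TendstoUniformly (fun j (x : HilbertCube) => u j x k) (fun x => x k) atTop := by
    rw [Metric.tendstoUniformly_iff]
    intro ε hε
    by_cases h : k = n
    · subst h
      filter_upwards [hδ.eventually (gt_mem_nhds hε)] with j hj x
      rw [dist_comm]
      exact (hn j x).trans_lt hj
    · filter_upwards [hk k h] with j hj x
      rwa [hj, dist_self]
  exact tendstoUniformly_iff_tendsto.1 this

open Filter in
/-- The closed set of points of the Hilbert cube whose coordinates avoid given intervals is moved
in the pseudo-interior by some ambient homeomorphism. -/
lemma exists_homeo_inner {c d : ℕ → Icc (0:ℝ) 1} (hcd : ∀ k, c k < d k) :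
    ∃ h : HilbertCube ≃ₜ HilbertCube, ∀ x : HilbertCube, (∀ k, x k ∉ Ioo (c k) (d k)) →
      ∀ k, h x k ∈ innerIcc := by
  set K : Set HilbertCube := {x | ∀ k, x k ∉ Ioo (c k) (d k)} with hK
  have hKc : IsCompact K := by
    refine IsClosed.isCompact ?_
    rw [hK, ofPred_forall]
    exact isClosed_iInter fun k => (isOpen_Ioo.preimage (continuous_apply k)).isClosed_compl
  let E := C(HilbertCube, HilbertCube) × C(HilbertCube, HilbertCube)
  let Inv : Set E := {p | p.1.comp p.2 = ContinuousMap.id _ ∧ p.2.comp p.1 = ContinuousMap.id _}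
  let G : Set E := {p | p ∈ Inv ∧ ∃ N, ∀ k ≥ N, ∀ x, p.1 x k = x k}
  have hInv : IsClosed Inv :=
    (isClosed_eq (continuous_fst.compCM continuous_snd) continuous_const).inter
      (isClosed_eq (continuous_snd.compCM continuous_fst) continuous_const)
  have hGI : closure G ⊆ Inv := closure_minimal (fun p hp => hp.1) hInv
  have : CompleteSpace (closure G) := isClosed_closure.completeSpace_coe
  let O : ℕ → Set E := fun n => {p | MapsTo p.1 K {x | x n ∈ innerIcc}}
  have hO : ∀ n, IsOpen (O n) := fun n =>
    (ContinuousMap.isOpen_setOfPred_mapsTo hKc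
      (isOpen_innerIcc.preimage (continuous_apply n))).preimage continuous_fst
  have hdense : ∀ n, G ⊆ closure (G ∩ O n) := by
    rintro n p ⟨⟨hp1, hp2⟩, N, hN⟩
    let m : ℕ → ℕ := fun j => j + N + n + 1
    have hnm : ∀ j, n ≠ m j := fun j => by simp only [m]; omega
    choose φ hφ1 hφ2 hφ3 using fun j : ℕ =>
      exists_homeo_square (hcd (m j)) (Nat.one_div_pos_of_nat (α := ℝ) (n := j))
    let u : ℕ → C(HilbertCube, HilbertCube) := fun j => ⟨twist (hnm j) (φ j), by fun_prop⟩
    let v : ℕ → C(HilbertCube, HilbertCube) := fun j => ⟨(twist (hnm j) (φ j)).symm, by fun_prop⟩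
    have huv : ∀ j, (u j).comp (v j) = ContinuousMap.id _ := fun j => by ext1 x; simp [u, v]
    have hvu : ∀ j, (v j).comp (u j) = ContinuousMap.id _ := fun j => by ext1 x; simp [u, v]
    have hu : Tendsto u atTop (𝓝 (ContinuousMap.id _)) := by
      refine tendsto_hilbertCube_id (n := n) tendsto_one_div_add_atTop_nhds_zero_nat
        (fun j x => ?_) fun k hk => ?_
      · change dist (twist (hnm j) (φ j) x n) _ ≤ _
        rw [twist_apply_left]; exact hφ1 j _
      · filter_upwards [eventually_ge_atTop k] with j hj x
        exact twist_apply_of_ne _ _ _ hk (by simp only [m]; omega)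
    have hv : Tendsto v atTop (𝓝 (ContinuousMap.id _)) := by
      refine tendsto_hilbertCube_id (n := n) tendsto_one_div_add_atTop_nhds_zero_nat
        (fun j x => ?_) fun k hk => ?_
      · change dist ((twist (hnm j) (φ j)).symm x n) _ ≤ _
        rw [twist_symm_apply_left]; exact hφ2 j _
      · filter_upwards [eventually_ge_atTop k] with j hj x
        exact twist_symm_apply_of_ne _ _ _ hk (by simp only [m]; omega)
    have ht : Tendsto (fun j => ((u j).comp p.1, p.2.comp (v j))) atTop (𝓝 p) := by
      have h1 := hu.compCM (tendsto_const_nhds (x := p.1))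
      have h2 := (tendsto_const_nhds (x := p.2)).compCM hv
      rw [ContinuousMap.id_comp] at h1
      rw [ContinuousMap.comp_id] at h2
      exact h1.prodMk_nhds h2
    refine mem_closure_of_tendsto ht (Eventually.of_forall fun j => ⟨⟨⟨?_, ?_⟩, m j + 1, ?_⟩, ?_⟩)
    · change ((u j).comp p.1).comp (p.2.comp (v j)) = _
      rw [ContinuousMap.comp_assoc, ← ContinuousMap.comp_assoc p.1, hp1, ContinuousMap.id_comp, huv]
    · change (p.2.comp (v j)).comp ((u j).comp p.1) = _
      rw [ContinuousMap.comp_assoc, ← ContinuousMap.comp_assoc (v j), hvu, ContinuousMap.id_comp, hp2]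
    · intro k hk x
      change twist (hnm j) (φ j) (p.1 x) k = x k
      rw [twist_apply_of_ne _ _ _ (by simp only [m] at hk; omega) (by omega),
        hN k (by simp only [m] at hk; omega)]
    · intro x hx
      change twist (hnm j) (φ j) (p.1 x) n ∈ innerIcc
      rw [twist_apply_left]
      refine hφ3 j _ ?_
      change p.1 x (m j) ∉ _
      rw [hN (m j) (by simp only [m]; omega)]
      exact hx (m j)
  have hne : Nonempty (closure G) := by
    refine ⟨(ContinuousMap.id _, ContinuousMap.id _), subset_closure ⟨⟨?_, ?_⟩, 0, ?_⟩⟩ <;> simp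
  obtain ⟨⟨p, hp⟩, hpO⟩ := (dense_iInter_of_isOpen_nat
    (f := fun n => (Subtype.val ⁻¹' O n : Set (closure G)))
    (fun n => (hO n).preimage continuous_subtype_val) (fun n => Subtype.dense_iff.2 <| by
      rw [Subtype.image_preimage_coe]
      refine closure_minimal ((hdense n).trans (closure_mono ?_)) isClosed_closure
      exact inter_subset_inter_left _ subset_closure)).nonempty
  have hI := hGI hp
  refine ⟨⟨⟨p.1, p.2, fun x => DFunLike.congr_fun hI.2 x, fun x => DFunLike.congr_fun hI.1 x⟩,
    p.1.continuous, p.2.continuous⟩, fun x hx k => ?_⟩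
  exact mem_iInter.1 hpO k hx

lemma not_countable_cantor : ¬ Countable (ℕ → Bool) := by
  rw [← Cardinal.mk_le_aleph0_iff, not_le]
  simpa using Cardinal.aleph0_lt_continuum

lemma exists_cantor_real : ∃ e : (ℕ → Bool) → ℝ, Continuous e ∧ Function.Injective e := by
  obtain ⟨f, -, hf⟩ := isClosed_univ.exists_nat_bool_injection_of_not_countable
    Cardinal.not_countable_real
  exact ⟨f, hf⟩

/-- A topological embedding of the Cantor cube in the Hilbert cube, onto a set lying on a
segment parallel to the axis `0`. -/
noncomputable def flatCantor (z : ℕ → Bool) : HilbertCube := stdLine (exists_cantor_real.choose z)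

lemma continuous_flatCantor : Continuous flatCantor :=
  continuous_stdLine.comp exists_cantor_real.choose_spec.1

lemma flatCantor_injective : Function.Injective flatCantor := fun _ _ h =>
  exists_cantor_real.choose_spec.2 (stdLine_apply_zero_injective (congrFun h 0))

lemma isCantorSet_range {f : (ℕ → Bool) → HilbertCube} (hf : Continuous f)
    (hinj : Function.Injective f) : IsCantorSet (range f) :=
  ⟨(hf.isClosedEmbedding hinj).isEmbedding.toHomeomorph.symm⟩

/-- A compact set avoiding coordinate-wise some intervals is moved by an ambient homeomorphism
into the standard Cantor set. -/
lemma exists_homeo_flatCantor {X : Type*} [TopologicalSpace X] [CompactSpace X]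
    {a : X → HilbertCube} (ha : Continuous a) (hinj : Function.Injective a)
    {c d : ℕ → Icc (0:ℝ) 1} (hcd : ∀ k, c k < d k) (hav : ∀ x k, a x k ∉ Ioo (c k) (d k))
    {e : X → ℕ → Bool} (he : Continuous e) (heinj : Function.Injective e) :
    ∃ g : HilbertCube ≃ₜ HilbertCube, ∀ x, g (a x) = flatCantor (e x) := by
  obtain ⟨h, hh⟩ := exists_homeo_inner hcd
  obtain ⟨g, hg⟩ := exists_homeo_stdLine (h.continuous.comp ha) (h.injective.comp hinj)
    (fun x k => hh _ (hav x) k) (exists_cantor_real.choose_spec.1.comp he)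
    (exists_cantor_real.choose_spec.2.comp heinj)
  exact ⟨h.trans g, hg⟩

open MeasureTheory in
/-- An uncountable closed set has an uncountable part avoiding coordinate-wise some intervals. -/
lemma exists_not_countable_avoiding {B : Set HilbertCube} (hB : IsClosed B) (hBu : ¬ B.Countable) :
    ∃ c d : ℕ → Icc (0:ℝ) 1, (∀ k, c k < d k) ∧
      ¬ (B ∩ {x | ∀ k, x k ∉ Ioo (c k) (d k)}).Countable := by
  have : StandardBorelSpace B := hB.measurableSet.standardBorel
  have β : ℝ ≃ᵐ B := PolishSpace.measurableEquivOfNotCountable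
    (fun h => Cardinal.not_countable_real (countable_univ_iff.2 h))
    (fun h => hBu (countable_coe_iff.1 h))
  let μ : Measure ℝ := volume.restrict (Icc 0 1)
  have hμ : μ univ = 1 := by simp [μ]
  let p : ℕ → Icc (0:ℝ) 1 := fun i => ⟨1 / (i + 1 : ℝ), by positivity,
    div_le_one_of_le₀ (by linarith [(Nat.cast_nonneg i : (0:ℝ) ≤ i)]) (by positivity)⟩
  have hp : StrictAnti p := by
    intro i j hij
    have : (i:ℝ) < j := Nat.cast_lt.2 hij
    change 1 / ((j:ℝ) + 1) < 1 / ((i:ℝ) + 1)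
    exact one_div_lt_one_div_of_lt (by positivity) (by linarith)
  have hm : ∀ k, Measurable fun t => (β t : HilbertCube) k := fun k =>
    (measurable_pi_apply k).comp (measurable_subtype_coe.comp β.measurable)
  obtain ⟨ε, hε, hεs⟩ := ENNReal.exists_pos_sum_of_countable (one_ne_zero (α := ENNReal)) ℕ
  have hi : ∀ k, ∃ i, μ ((fun t => (β t : HilbertCube) k) ⁻¹' Ioo (p (i + 1)) (p i)) ≤ ε k := by
    intro k
    have h1 : ∑' i, μ ((fun t => (β t : HilbertCube) k) ⁻¹' Ioo (p (i + 1)) (p i)) ≠ ⊤ := by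
      refine ne_top_of_le_ne_top (b := μ univ) (by simp [hμ])
        ((tsum_meas_le_meas_iUnion_of_disjoint μ (fun i => hm k measurableSet_Ioo) ?_).trans
          (measure_mono (subset_univ _)))
      intro i j hij
      exact (hp.antitone.pairwise_disjoint_on_Ioo_succ hij).preimage _
    exact ((ENNReal.tendsto_atTop_zero_of_tsum_ne_top h1).eventually
      (ge_mem_nhds (by exact_mod_cast hε k))).exists
  choose i hi using hi
  refine ⟨fun k => p (i k + 1), fun k => p (i k), fun k => hp (Nat.lt_succ_self _), fun hc => ?_⟩
  have hc' : ((⋃ k, (fun t => (β t : HilbertCube) k) ⁻¹' Ioo (p (i k + 1)) (p (i k)))ᶜ).Countable := by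
    refine MapsTo.countable_of_injOn (f := fun t => (β t : HilbertCube)) ?_
      (fun s _ t _ h => β.injective (Subtype.ext h)) hc
    intro t ht
    refine ⟨(β t).2, fun k hk => ht (mem_iUnion.2 ⟨k, hk⟩)⟩
  have h1 := measure_univ_le_add_compl (μ := μ)
    (⋃ k, (fun t => (β t : HilbertCube) k) ⁻¹' Ioo (p (i k + 1)) (p (i k)))
  rw [hc'.measure_zero, add_zero, hμ] at h1
  exact absurd (h1.trans ((measure_iUnion_le _).trans (ENNReal.tsum_le_tsum hi))) (not_le.2 hεs)

lemma IsCantorSet.isClosed {B : Set HilbertCube} (hB : IsCantorSet B) : IsClosed B := by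
  obtain ⟨h⟩ := hB
  have := h.symm.compactSpace
  exact (isCompact_iff_compactSpace.2 this).isClosed

lemma IsCantorSet.not_countable {B : Set HilbertCube} (hB : IsCantorSet B) : ¬ B.Countable := by
  obtain ⟨h⟩ := hB
  intro hc
  have := hc.to_subtype
  exact not_countable_cantor h.symm.injective.countable

/-- The preimages of the standard Cantor set by homeomorphisms are minimal. -/
lemma isMinimalCantorSet_preimage_flatCantor (g : HilbertCube ≃ₜ HilbertCube) :
    IsMinimalCantorSet (g ⁻¹' range flatCantor) := by
  constructor
  · rw [← g.image_symm, ← range_comp]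
    exact isCantorSet_range (g.symm.continuous.comp continuous_flatCantor)
      (g.symm.injective.comp flatCantor_injective)
  intro B hB
  obtain ⟨c, d, hcd, hu⟩ := exists_not_countable_avoiding hB.isClosed hB.not_countable
  have hcl : IsClosed {x : HilbertCube | ∀ k, x k ∉ Ioo (c k) (d k)} := by
    rw [ofPred_forall]
    exact isClosed_iInter fun k => (isOpen_Ioo.preimage (continuous_apply k)).isClosed_compl
  obtain ⟨b, hbr, hb, hbi⟩ := (hB.isClosed.inter hcl).exists_nat_bool_injection_of_not_countable hu
  obtain ⟨f, hf⟩ := exists_homeo_flatCantor hb hbi hcd (fun x k => (hbr ⟨x, rfl⟩).2 k)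
    continuous_id Function.injective_id
  refine ⟨g.trans f.symm, ?_⟩
  rintro _ ⟨x, ⟨z, hz⟩, rfl⟩
  change f.symm (g x) ∈ B
  rw [← hz, ← id_eq z, ← hf z, f.symm_apply_apply]
  exact (hbr ⟨z, rfl⟩).1

/-- A compact set whose coordinate projections have dense complements is contained in a minimal
Cantor set. -/
lemma mem_sigmaC0_of_dense_compl {K : Set HilbertCube} (hK : IsCompact K)
    (hd : ∀ k, Dense (Function.eval k '' K)ᶜ) : K ∈ sigmaC0 := by
  have := isCompact_iff_compactSpace.1 hK
  have hD : ∀ k, ∃ D : ℕ → Icc (0:ℝ) 1, DenseRange D ∧ ∀ j, D j ∉ Function.eval k '' K := by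
    intro k
    obtain ⟨t, hts, htc, htd⟩ := (hd k).exists_countable_dense_subset
    obtain ⟨D, rfl⟩ := htc.exists_eq_range htd.nonempty
    exact ⟨D, htd, fun j => hts ⟨j, rfl⟩⟩
  choose D hDd hDn using hD
  have hI : ∀ k, ∃ c d, c < d ∧ Ioo c d ⊆ (Function.eval k '' K)ᶜ := by
    intro k
    obtain ⟨z, hz, hz0, -⟩ := (hd k).exists_between (zero_lt_one (α := Icc (0:ℝ) 1))
    have ho := (hK.image (continuous_apply k)).isClosed.isOpen_compl
    obtain ⟨c, hc, hcz⟩ := exists_Ioc_subset_of_mem_nhds (ho.mem_nhds hz) ⟨0, hz0⟩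
    exact ⟨c, z, hc, Ioo_subset_Ioc_self.trans hcz⟩
  choose c d hcd hIoo using hI
  let e : K → ℕ → Bool := fun x i =>
    decide (D (Nat.unpair i).1 (Nat.unpair i).2 < (x : HilbertCube) (Nat.unpair i).1)
  have he : Continuous e := by
    refine continuous_pi fun i => (continuous_bool_rng true).2 ?_
    have h1 : (fun x => e x i) ⁻¹' {true} =
        {x : K | D (Nat.unpair i).1 (Nat.unpair i).2 < (x : HilbertCube) (Nat.unpair i).1} := by
      ext x; simp [e]
    have h2 : (fun x => e x i) ⁻¹' {true} =
        {x : K | D (Nat.unpair i).1 (Nat.unpair i).2 ≤ (x : HilbertCube) (Nat.unpair i).1} := by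
      rw [h1]
      ext x
      rw [mem_ofPred_eq, mem_ofPred_eq]
      refine ⟨le_of_lt, fun h => ?_⟩
      exact h.lt_of_ne fun h' => hDn _ _ ⟨x, x.2, h'.symm⟩
    have hc : Continuous fun x : K => (x : HilbertCube) (Nat.unpair i).1 :=
      (continuous_apply _).comp continuous_subtype_val
    exact ⟨h2 ▸ isClosed_le continuous_const hc, h1 ▸ isOpen_lt continuous_const hc⟩
  have hlt : ∀ (x y : K) k, (x : HilbertCube) k < (y : HilbertCube) k → e x ≠ e y := by
    intro x y k hxy h
    obtain ⟨_, ⟨j, rfl⟩, h1, h2⟩ := (hDd k).exists_between hxy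
    have := congrFun h (Nat.pair k j)
    simp only [e, Nat.unpair_pair, h2, decide_true, decide_eq_true_eq] at this
    exact this.not_gt h1
  have hei : Function.Injective e := by
    intro x y h
    by_contra hne
    obtain ⟨k, hk⟩ := Function.ne_iff.1 fun h' => hne (Subtype.ext h')
    rcases hk.lt_or_gt with hk | hk
    exacts [hlt x y k hk h, hlt y x k hk h.symm]
  obtain ⟨g, hg⟩ := exists_homeo_flatCantor continuous_subtype_val Subtype.val_injective hcd
    (fun (x : K) k hx => hIoo k hx ⟨x, x.2, rfl⟩) he hei
  refine ⟨fun _ => g ⁻¹' range flatCantor, fun _ => isMinimalCantorSet_preimage_flatCantor g,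
    fun x hx => mem_iUnion.2 ⟨0, ?_⟩⟩
  exact ⟨_, (hg ⟨x, hx⟩).symm⟩

lemma sigmaC0_subset_meagerIdeal : sigmaC0 ⊆ MeagerIdeal HilbertCube := by
  rintro A ⟨S, hS, hA⟩
  refine IsMeagre.mono hA (isMeagre_iUnion fun n => ?_)
  obtain ⟨hC, hmin⟩ := hS n
  obtain ⟨h, hh⟩ := hmin _ (isCantorSet_range continuous_flatCantor flatCantor_injective)
  apply IsNowhereDense.isMeagre
  rw [hC.isClosed.isNowhereDense_iff, eq_empty_iff_forall_notMem]
  intro x hx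
  have hU : IsOpen (h '' interior (S n)) := h.isOpenMap _ isOpen_interior
  have hx' : h x ∈ h '' interior (S n) := mem_image_of_mem _ hx
  have hsub : h '' interior (S n) ⊆ {y | y 1 = midIcc} := by
    refine (image_mono interior_subset).trans (hh.trans ?_)
    rintro _ ⟨z, rfl⟩
    simp [flatCantor, stdLine]
  have hcont : Continuous fun t : Icc (0:ℝ) 1 => Function.update (h x) 1 t := by fun_prop
  have hopen := hU.preimage hcont
  have hmid : h x 1 = midIcc := hsub hx'
  have heq : (fun t : Icc (0:ℝ) 1 => Function.update (h x) 1 t) ⁻¹' (h '' interior (S n)) =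
      {midIcc} := by
    ext t
    constructor
    · intro ht
      have := hsub ht
      simpa using this
    · rintro rfl
      rw [mem_preimage, ← hmid, Function.update_eq_self]
      exact hx'
  rw [heq] at hopen
  rcases isClopen_iff.1 ⟨isClosed_singleton, hopen⟩ with h1 | h1
  · exact singleton_ne_empty _ h1
  · have h0 : (0 : Icc (0:ℝ) 1) = midIcc := by
      rw [← mem_singleton_iff, h1]; trivial
    exact midIcc_mem_inner.1.ne (congrArg Subtype.val h0)

section SingletonFibers

variable {X Y : Type*} [TopologicalSpace X] [TopologicalSpace Y] {f : X → Y} {D : Set X}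

/-- Preimages of nowhere dense sets under maps with a dense set of singleton fibers. -/
lemma IsNowhereDense.preimage_of_fibers [CompactSpace X] [T2Space Y] (hf : Continuous f)
    (hs : Function.Surjective f) (hD : Dense D) (hfib : ∀ x ∈ D, ∀ y, f y = f x → y = x)
    {F : Set Y} (hF : IsNowhereDense F) : IsNowhereDense (f ⁻¹' F) := by
  have hcl : IsClosed (f ⁻¹' closure F) := isClosed_closure.preimage hf
  refine IsNowhereDense.mono (preimage_mono subset_closure) ?_
  rw [hcl.isNowhereDense_iff, ← not_nonempty_iff_eq_empty]
  intro hne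
  obtain ⟨x, hxU, hxD⟩ := hD.inter_open_nonempty _ isOpen_interior hne
  have hV : IsOpen (f '' (interior (f ⁻¹' closure F))ᶜ)ᶜ :=
    (isOpen_interior.isClosed_compl.isCompact.image hf).isClosed.isOpen_compl
  have hsub : (f '' (interior (f ⁻¹' closure F))ᶜ)ᶜ ⊆ closure F := by
    intro y hy
    obtain ⟨z, rfl⟩ := hs y
    by_contra hz
    exact hy ⟨z, fun hzi => hz (show z ∈ f ⁻¹' closure F from interior_subset hzi), rfl⟩
  have hx : f x ∈ (f '' (interior (f ⁻¹' closure F))ᶜ)ᶜ := by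
    rintro ⟨z, hz, hzx⟩
    rw [hfib x hxD z hzx] at hz
    exact hz hxU
  have : f x ∈ interior (closure F) := mem_interior.2 ⟨_, hsub, hV, hx⟩
  rw [hF] at this
  exact this

/-- Images of closed nowhere dense sets under maps with a dense set of singleton fibers. -/
lemma IsNowhereDense.image_of_fibers [CompactSpace X] [T2Space Y] (hf : Continuous f)
    (hs : Function.Surjective f) (hD : Dense D) (hfib : ∀ x ∈ D, ∀ y, f y = f x → y = x)
    {K : Set X} (hK : IsNowhereDense K) : IsNowhereDense (f '' K) := by
  have hcl : IsClosed (f '' closure K) := (isClosed_closure.isCompact.image hf).isClosed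
  refine IsNowhereDense.mono (image_mono subset_closure) ?_
  rw [hcl.isNowhereDense_iff, ← not_nonempty_iff_eq_empty]
  rintro ⟨y, hy⟩
  obtain ⟨x, rfl⟩ := hs y
  have hU : IsOpen (f ⁻¹' interior (f '' closure K)) := isOpen_interior.preimage hf
  have hne : (f ⁻¹' interior (f '' closure K) ∩ (closure K)ᶜ).Nonempty := by
    by_contra h
    have hsub : f ⁻¹' interior (f '' closure K) ⊆ closure K := fun z hz =>
      by_contra fun hz' => h ⟨z, hz, hz'⟩
    have : x ∈ interior (closure K) := mem_interior.2 ⟨_, hsub, hU, hy⟩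
    rw [hK] at this
    exact this
  obtain ⟨z, ⟨hz, hzK⟩, hzD⟩ :=
    hD.inter_open_nonempty _ (hU.inter isClosed_closure.isOpen_compl) hne
  obtain ⟨w, hw, hwz⟩ := interior_subset hz
  rw [hfib z hzD w hwz] at hw
  exact hzK hw

lemma IsMeagre.preimage_of_fibers [CompactSpace X] [T2Space Y] (hf : Continuous f)
    (hs : Function.Surjective f) (hD : Dense D) (hfib : ∀ x ∈ D, ∀ y, f y = f x → y = x)
    {F : Set Y} (hF : IsMeagre F) : IsMeagre (f ⁻¹' F) := by
  obtain ⟨S, hS, hSc, hFS⟩ := isMeagre_iff_countable_union_isNowhereDense.1 hF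
  refine IsMeagre.mono (preimage_mono hFS) ?_
  rw [preimage_sUnion]
  exact isMeagre_biUnion hSc fun t ht =>
    ((hS t ht).preimage_of_fibers hf hs hD hfib).isMeagre

lemma IsMeagre.image_of_fibers [CompactSpace X] [T2Space Y] (hf : Continuous f)
    (hs : Function.Surjective f) (hD : Dense D) (hfib : ∀ x ∈ D, ∀ y, f y = f x → y = x)
    {K : Set X} (hK : IsMeagre K) : IsMeagre (f '' K) := by
  obtain ⟨S, hS, hSc, hKS⟩ := isMeagre_iff_countable_union_isNowhereDense.1 hK
  refine IsMeagre.mono (image_mono hKS) ?_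
  rw [sUnion_eq_biUnion, image_iUnion₂]
  exact isMeagre_biUnion hSc fun t ht =>
    ((hS t ht).image_of_fibers hf hs hD hfib).isMeagre

end SingletonFibers

lemma exists_cylinder_subset {U : Set (ℕ → Bool)} (hU : IsOpen U) {x : ℕ → Bool} (hx : x ∈ U) :
    ∃ N, ∀ y : ℕ → Bool, (∀ i < N, y i = x i) → y ∈ U := by
  obtain ⟨J, u, hu, hJ⟩ := isOpen_pi_iff.1 hU x hx
  refine ⟨J.sup id + 1, fun y hy => hJ fun i hi => ?_⟩
  rw [hy i (Nat.lt_succ_of_le (Finset.le_sup (f := id) hi))]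
  exact (hu i hi).2

/-- The point of `[0,1]` with a given binary expansion. -/
noncomputable def binPoint (z : ℕ → Bool) : Icc (0:ℝ) 1 :=
  ⟨Real.ofDigits fun i => if z i then (1 : Fin 2) else 0, Real.ofDigits_nonneg _,
    Real.ofDigits_le_one _⟩

lemma continuous_binPoint : Continuous binPoint := by
  refine Continuous.subtype_mk (Real.continuous_ofDigits.comp (continuous_pi fun i => ?_)) _
  exact (continuous_of_discreteTopology (f := fun b : Bool => if b then (1 : Fin 2) else 0)).comp
    (continuous_apply i)

lemma binPoint_surjective : Function.Surjective binPoint := by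
  intro y
  obtain ⟨a, -, ha⟩ := Real.ofDigits_SurjOn one_lt_two y.2
  refine ⟨fun i => decide (a i = 1), Subtype.ext ?_⟩
  rw [← ha]
  change Real.ofDigits _ = _
  congr 1
  funext i
  by_cases h : a i = 1
  · simp [h]
  · simp only [h, decide_false, Bool.false_eq_true, if_false]
    omega

lemma binPoint_eq (z : ℕ → Bool) :
    (binPoint z : ℝ) = ((if z 0 then 1 else 0) + binPoint fun i => z (i + 1)) / 2 := by
  have h := Real.ofDigits_eq_sum_add_ofDigits (fun i => if z i then (1 : Fin 2) else 0) 1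
  change Real.ofDigits _ = (_ + Real.ofDigits _) / 2
  rw [h]
  simp only [Finset.sum_range_one, Real.ofDigitsTerm]
  split_ifs <;> simp <;> ring

lemma eq_false_of_binPoint_eq_zero {z : ℕ → Bool} (h : (binPoint z : ℝ) = 0) (i : ℕ) :
    z i = false := by
  induction i generalizing z with
  | zero =>
    rw [binPoint_eq] at h
    have := (binPoint fun i => z (i + 1)).2.1
    by_contra hz
    simp only [Bool.not_eq_false] at hz
    simp only [hz, if_true] at h
    linarith
  | succ i ih =>
    refine ih (z := fun i => z (i + 1)) ?_
    rw [binPoint_eq] at h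
    have := (binPoint fun i => z (i + 1)).2.1
    split_ifs at h <;> linarith

lemma eq_true_of_binPoint_eq_one {z : ℕ → Bool} (h : (binPoint z : ℝ) = 1) (i : ℕ) :
    z i = true := by
  induction i generalizing z with
  | zero =>
    rw [binPoint_eq] at h
    have := (binPoint fun i => z (i + 1)).2.2
    by_contra hz
    simp only [Bool.not_eq_true] at hz
    simp only [hz] at h
    norm_num at h
    linarith
  | succ i ih =>
    refine ih (z := fun i => z (i + 1)) ?_
    rw [binPoint_eq] at h
    have := (binPoint fun i => z (i + 1)).2.2
    split_ifs at h <;> linarith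

/-- The binary sequences in which both digits occur infinitely often. -/
def mixing : Set (ℕ → Bool) := {z | ∀ b n, ∃ i ≥ n, z i = b}

lemma shift_mem_mixing {z : ℕ → Bool} (hz : z ∈ mixing) : (fun i => z (i + 1)) ∈ mixing := by
  intro b n
  obtain ⟨i, hi, hb⟩ := hz b (n + 1)
  exact ⟨i - 1, by omega, by simpa [Nat.sub_add_cancel (show 1 ≤ i by omega)] using hb⟩

lemma binPoint_fiber_zero {z : ℕ → Bool} (hz : z ∈ mixing) {w : ℕ → Bool}
    (h : (binPoint w : ℝ) = binPoint z) : w 0 = z 0 := by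
  have h1 := (binPoint fun i => w (i + 1)).2
  have h2 := (binPoint fun i => z (i + 1)).2
  rw [binPoint_eq, binPoint_eq z] at h
  cases hw0 : w 0 <;> cases hz0 : z 0 <;>
    simp only [hw0, hz0, if_true, Bool.false_eq_true, if_false] at h ⊢
  · obtain ⟨j, -, hj⟩ := shift_mem_mixing hz true 0
    have := eq_false_of_binPoint_eq_zero (z := fun i => z (i + 1)) (by linarith [h1.2, h2.1]) j
    simp [hj] at this
  · obtain ⟨j, -, hj⟩ := shift_mem_mixing hz false 0
    have := eq_true_of_binPoint_eq_one (z := fun i => z (i + 1)) (by linarith [h1.1, h2.2]) j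
    simp [hj] at this

lemma binPoint_fiber {z : ℕ → Bool} (hz : z ∈ mixing) (w : ℕ → Bool)
    (h : binPoint w = binPoint z) : w = z := by
  have h' : (binPoint w : ℝ) = binPoint z := congrArg _ h
  clear h
  funext i
  induction i generalizing w z with
  | zero => exact binPoint_fiber_zero hz h'
  | succ i ih =>
    refine ih (shift_mem_mixing hz) (fun i => w (i + 1)) ?_
    have h0 := binPoint_fiber_zero hz h'
    rw [binPoint_eq, binPoint_eq z, h0] at h'
    linarith

/-- The map of the Cantor cube onto the Hilbert cube which reads a binary sequence as an
infinite matrix and takes the binary expansions given by its rows. -/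
noncomputable def binMatrix (x : ℕ → Bool) : HilbertCube :=
  fun k => binPoint fun j => x (Nat.pair k j)

lemma continuous_binMatrix : Continuous binMatrix :=
  continuous_pi fun k => continuous_binPoint.comp (by fun_prop)

lemma binMatrix_surjective : Function.Surjective binMatrix := by
  intro y
  choose z hz using fun k => binPoint_surjective (y k)
  refine ⟨fun i => z (Nat.unpair i).1 (Nat.unpair i).2, funext fun k => ?_⟩
  rw [← hz k]
  simp [binMatrix]

/-- The binary matrices all of whose rows have infinitely many occurrences of both digits. -/
def rowMixing : Set (ℕ → Bool) := {x | ∀ k, (fun j => x (Nat.pair k j)) ∈ mixing}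

lemma dense_rowMixing : Dense rowMixing := by
  rw [dense_iff_inter_open]
  rintro U hU ⟨x, hx⟩
  obtain ⟨N, hN⟩ := exists_cylinder_subset hU hx
  refine ⟨fun i => if i < N then x i else decide (Even (Nat.unpair i).2),
    hN _ fun i hi => if_pos hi, fun k b n => ?_⟩
  have hge : ∀ j ≥ N, ¬ Nat.pair k j < N := fun j hj => by
    have := Nat.right_le_pair k j
    omega
  cases b
  · exact ⟨2 * (n + N) + 1, by omega, by simp [hge (2 * (n + N) + 1) (by omega)]⟩
  · exact ⟨2 * (n + N), by omega, by simp [hge (2 * (n + N)) (by omega)]⟩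

lemma dense_mixing : Dense mixing := by
  rw [dense_iff_inter_open]
  rintro U hU ⟨x, hx⟩
  obtain ⟨N, hN⟩ := exists_cylinder_subset hU hx
  refine ⟨fun i => if i < N then x i else decide (Even i), hN _ fun i hi => if_pos hi,
    fun b n => ?_⟩
  cases b
  · exact ⟨2 * (n + N) + 1, by omega, by simp [show ¬ 2 * (n + N) + 1 < N by omega]⟩
  · exact ⟨2 * (n + N), by omega, by simp [show ¬ 2 * (n + N) < N by omega]⟩

lemma binMatrix_fiber {x : ℕ → Bool} (hx : x ∈ rowMixing) (w : ℕ → Bool)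
    (h : binMatrix w = binMatrix x) : w = x := by
  funext i
  have := congrFun (binPoint_fiber (hx (Nat.unpair i).1) _ (congrFun h (Nat.unpair i).1))
    (Nat.unpair i).2
  simpa using this

open Filter

lemma isClosed_ne_on_finset (K : Finset ℕ) (y : ℕ → Bool) :
    IsClosed {w : ℕ → Bool | ∃ j ∈ K, w j ≠ y j} := by
  have : {w : ℕ → Bool | ∃ j ∈ K, w j ≠ y j} = ⋃ j ∈ K, (fun w => w j) ⁻¹' {y j}ᶜ := by
    ext w
    simp only [mem_ofPred_eq, mem_iUnion, mem_preimage, mem_compl_iff, mem_singleton_iff,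
      exists_prop, ne_eq]
  rw [this]
  exact K.finite_toSet.isClosed_biUnion fun j _ =>
    (isClosed_discrete _).preimage (continuous_apply j)

lemma isClosed_forall_ne_on (T : Set ℕ) (K : ℕ → Finset ℕ) (y : ℕ → Bool) :
    IsClosed {w : ℕ → Bool | ∀ l ∈ T, ∃ j ∈ K l, w j ≠ y j} := by
  have : {w : ℕ → Bool | ∀ l ∈ T, ∃ j ∈ K l, w j ≠ y j} =
      ⋂ l ∈ T, {w : ℕ → Bool | ∃ j ∈ K l, w j ≠ y j} := by
    ext w; simp
  rw [this]
  exact isClosed_biInter fun l _ => isClosed_ne_on_finset _ _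

lemma isNowhereDense_forall_ne_on {T : Set ℕ} {K : ℕ → Finset ℕ}
    (hK : ∀ N, ∃ l ∈ T, ∀ j ∈ K l, N ≤ j) (y : ℕ → Bool) :
    IsNowhereDense {w : ℕ → Bool | ∀ l ∈ T, ∃ j ∈ K l, w j ≠ y j} := by
  rw [(isClosed_forall_ne_on T K y).isNowhereDense_iff, eq_empty_iff_forall_notMem]
  intro x hx
  obtain ⟨N, hN⟩ := exists_cylinder_subset isOpen_interior hx
  obtain ⟨l, hl, hNl⟩ := hK N
  obtain ⟨j, hj, hne⟩ := interior_subset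
    (hN (fun i => if i < N then x i else y i) fun i hi => if_pos hi) l hl
  exact hne (if_neg (not_lt.2 (hNl j hj)))

lemma isMeagre_eventually_ne_on {K : ℕ → Finset ℕ} (hK : ∀ j, ∀ᶠ l in atTop, j ∉ K l)
    (y : ℕ → Bool) : IsMeagre {w : ℕ → Bool | ∀ᶠ l in atTop, ∃ j ∈ K l, w j ≠ y j} := by
  have : {w : ℕ → Bool | ∀ᶠ l in atTop, ∃ j ∈ K l, w j ≠ y j} ⊆
      ⋃ L : ℕ, {w : ℕ → Bool | ∀ l ∈ Ici L, ∃ j ∈ K l, w j ≠ y j} := by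
    intro w hw
    obtain ⟨L, hL⟩ := eventually_atTop.1 hw
    exact mem_iUnion.2 ⟨L, hL⟩
  refine IsMeagre.mono this (isMeagre_iUnion fun L => ?_)
  refine (isNowhereDense_forall_ne_on (fun N => ?_) y).isMeagre
  have h := (Finset.range N).eventually_all.2 fun j _ => hK j
  obtain ⟨l, hl, hlL⟩ := (h.and (eventually_ge_atTop L)).exists
  exact ⟨l, hlL, fun j hj => not_lt.1 fun hjN => hl j (Finset.mem_range.2 hjN) hj⟩

/-- The involution of the Cantor cube flipping the coordinates in a finite set. -/
def flipOn (A : Finset ℕ) : (ℕ → Bool) ≃ₜ (ℕ → Bool) where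
  toFun x i := if i ∈ A then !x i else x i
  invFun x i := if i ∈ A then !x i else x i
  left_inv x := by funext i; by_cases h : i ∈ A <;> simp [h]
  right_inv x := by funext i; by_cases h : i ∈ A <;> simp [h]
  continuous_toFun := continuous_pi fun i => by
    by_cases h : i ∈ A
    · simp only [h, if_true]
      exact (continuous_of_discreteTopology (f := Bool.not)).comp (continuous_apply i)
    · simp only [h, if_false]; exact continuous_apply i
  continuous_invFun := continuous_pi fun i => by
    by_cases h : i ∈ A
    · simp only [h, if_true]
      exact (continuous_of_discreteTopology (f := Bool.not)).comp (continuous_apply i)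
    · simp only [h, if_false]; exact continuous_apply i

lemma flipOn_apply (A : Finset ℕ) (x : ℕ → Bool) (i : ℕ) :
    flipOn A x i = if i ∈ A then !x i else x i := rfl

/-- The combinatorial description of meager sets in the Cantor cube. -/
lemma IsMeagre.exists_blocks {E : Set (ℕ → Bool)} (hE : IsMeagre E) :
    ∃ q : ℕ → ℕ, StrictMono q ∧ ∃ y : ℕ → Bool, ∀ x ∈ E, ∀ᶠ n in atTop,
      ∃ i ∈ Finset.Ico (q n) (q (n + 1)), x i ≠ y i := by
  obtain ⟨t, htE, htG, htD⟩ := mem_residual.1 hE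
  obtain ⟨f, hfo, hft⟩ := htG.eq_iInter_nat
  have htf : ∀ n, t ⊆ f n := fun n => hft ▸ iInter_subset f n
  obtain ⟨y, hy⟩ := (dense_iInter_of_Gδ (fun A : Finset ℕ => htG.preimage (flipOn A).continuous)
    fun A => htD.preimage (flipOn A).isOpenMap).nonempty
  have hy' : ∀ A, flipOn A y ∈ t := fun A => mem_iInter.1 hy A
  have step : ∀ n a, ∃ b, a < b ∧ ∀ x : ℕ → Bool, (∀ i ∈ Finset.Ico a b, x i = y i) →
      ∀ k ≤ n, x ∈ f k := by
    intro n a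
    have hG : IsOpen (⋂ k ∈ Iic n, f k) := (finite_Iic n).isOpen_biInter fun k _ => hfo k
    choose N hN using fun A => exists_cylinder_subset hG
      (mem_iInter₂.2 fun k _ => htf k (hy' A))
    refine ⟨max (a + 1) ((Finset.range a).powerset.sup N), by omega, fun x hx k hk => ?_⟩
    let A := (Finset.range a).filter fun i => x i ≠ y i
    refine mem_iInter₂.1 (hN A x fun i hi => ?_) k hk
    have hNA : N A ≤ (Finset.range a).powerset.sup N :=
      Finset.le_sup (Finset.mem_powerset.2 (Finset.filter_subset _ _))
    rw [flipOn_apply]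
    by_cases hia : i < a
    · by_cases hxy : x i = y i
      · simp [A, hxy]
      · have hA : i ∈ A := by simp [A, hia, hxy]
        rw [if_pos hA]
        exact Bool.eq_not_of_ne hxy
    · have hA : i ∉ A := by simp [A, hia]
      rw [if_neg hA]
      exact hx i (Finset.mem_Ico.2 ⟨by omega, by omega⟩)
  choose b hb hbx using step
  let q : ℕ → ℕ := fun n => Nat.rec 0 b n
  refine ⟨q, strictMono_nat_of_lt_succ fun n => hb n (q n), y, fun x hx => ?_⟩
  by_contra h
  refine htE (show x ∈ t from ?_) hx
  rw [hft]
  refine mem_iInter.2 fun k => ?_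
  obtain ⟨n, hn, hkn⟩ := ((not_eventually.1 h).and_eventually (eventually_ge_atTop k)).exists
  push Not at hn
  exact hbx n (q n) x hn k hkn

/-- The set of binary matrices `x` such that each row `k` differs from `y` somewhere in each
interval `[p m, p (m + 1))` with `m ∈ R k`. -/
def blockSet (p : ℕ → ℕ) (R : ℕ → Set ℕ) (y : ℕ → Bool) : Set (ℕ → Bool) :=
  {x | ∀ k, ∀ m ∈ R k, ∃ j ∈ Finset.Ico (p m) (p (m + 1)), x (Nat.pair k j) ≠ y j}

lemma image_blockSet_mem_sigmaC0 {p : ℕ → ℕ} (hp : StrictMono p) {R : ℕ → Set ℕ}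
    (hR : ∀ k N, ∃ m ∈ R k, N ≤ m) (y : ℕ → Bool) : binMatrix '' blockSet p R y ∈ sigmaC0 := by
  have hrow : ∀ k, Continuous fun (x : ℕ → Bool) j => x (Nat.pair k j) := fun k => by fun_prop
  have hcl : IsClosed (blockSet p R y) := by
    have : blockSet p R y = ⋂ k, (fun (x : ℕ → Bool) j => x (Nat.pair k j)) ⁻¹'
        {w : ℕ → Bool | ∀ m ∈ R k, ∃ j ∈ Finset.Ico (p m) (p (m + 1)), w j ≠ y j} := by
      ext x; simp [blockSet]
    rw [this]
    exact isClosed_iInter fun k => (isClosed_forall_ne_on _ _ _).preimage (hrow k)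
  refine mem_sigmaC0_of_dense_compl (hcl.isCompact.image continuous_binMatrix) fun k => ?_
  rw [← interior_eq_empty_iff_dense_compl]
  have hnd : IsNowhereDense (binPoint ''
      {w : ℕ → Bool | ∀ m ∈ R k, ∃ j ∈ Finset.Ico (p m) (p (m + 1)), w j ≠ y j}) := by
    refine IsNowhereDense.image_of_fibers continuous_binPoint binPoint_surjective dense_mixing
      (fun z hz w => binPoint_fiber hz w) (isNowhereDense_forall_ne_on (fun N => ?_) y)
    obtain ⟨m, hm, hNm⟩ := hR k N
    exact ⟨m, hm, fun j hj => (hNm.trans hp.le_apply).trans (Finset.mem_Ico.1 hj).1⟩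
  rw [← subset_empty_iff, ← hnd]
  refine interior_mono (Subset.trans ?_ subset_closure)
  rintro _ ⟨_, ⟨x, hx, rfl⟩, rfl⟩
  exact ⟨_, hx k, rfl⟩

lemma pair_le_pair {a b c d : ℕ} (h₁ : a ≤ b) (h₂ : c ≤ d) : Nat.pair a c ≤ Nat.pair b d :=
  (StrictMono.monotone (f := fun a => Nat.pair a c) (fun _ _ => Nat.pair_lt_pair_left c) h₁).trans
    (StrictMono.monotone (f := Nat.pair b) (fun _ _ => Nat.pair_lt_pair_right b) h₂)

/-- If a block set is contained in the meager set given by `q` and `z`, then almost all intervals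
of `q` contain a test of the block set on which `z` agrees with `y`. -/
lemma blockSet_subset_eventually {p : ℕ → ℕ} (hp : StrictMono p) {R : ℕ → Set ℕ} {y : ℕ → Bool}
    {q : ℕ → ℕ} (hq : StrictMono q) {z : ℕ → Bool}
    (h : ∀ x ∈ blockSet p R y, ∀ᶠ l in atTop, ∃ i ∈ Finset.Ico (q l) (q (l + 1)), x i ≠ z i) :
    ∀ᶠ l in atTop, ∃ k, ∃ m ∈ R k, ∀ j ∈ Finset.Ico (p m) (p (m + 1)),
      Nat.pair k j ∈ Finset.Ico (q l) (q (l + 1)) ∧ z (Nat.pair k j) = y j := by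
  classical
  by_contra hbad
  rw [not_eventually, frequently_atTop] at hbad
  choose nxt hnxt hbad using hbad
  let b : ℕ → ℕ := fun l => Nat.pair (q (l + 1)) (p (q (l + 1) + 1))
  have hb : ∀ l k m j j', j ∈ Finset.Ico (p m) (p (m + 1)) → j' ∈ Finset.Ico (p m) (p (m + 1)) →
      Nat.pair k j < q (l + 1) → Nat.pair k j' ≤ b l := by
    intro l k m j j' hj hj' hlt
    have h1 := Nat.left_le_pair k j
    have h2 := Nat.right_le_pair k j
    have h3 : m ≤ p m := hp.le_apply
    have h4 := Finset.mem_Ico.1 hj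
    have h5 : p (m + 1) ≤ p (q (l + 1) + 1) := hp.monotone (by omega)
    have h6 := Finset.mem_Ico.1 hj'
    exact pair_le_pair (by omega) (by omega)
  let L : ℕ → ℕ := fun n => Nat.rec (nxt 0) (fun _ l => nxt (max (l + 1) (b l + 1))) n
  have hLs : ∀ n, L (n + 1) = nxt (max (L n + 1) (b (L n) + 1)) := fun n => rfl
  have hLmono : StrictMono L := strictMono_nat_of_lt_succ fun n => by
    have := hnxt (max (L n + 1) (b (L n) + 1))
    rw [hLs]; omega
  have hLb : ∀ n n', n < n' → b (L n) < q (L n') := by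
    intro n n' hn
    have h1 := hnxt (max (L n + 1) (b (L n) + 1))
    have h2 : L (n + 1) ≤ L n' := hLmono.monotone hn
    have h3 : L n' ≤ q (L n') := hq.le_apply
    rw [← hLs] at h1
    omega
  have hLbad : ∀ n k, ∀ m ∈ R k, ∃ j ∈ Finset.Ico (p m) (p (m + 1)),
      Nat.pair k j ∈ Finset.Ico (q (L n)) (q (L n + 1)) → z (Nat.pair k j) ≠ y j := by
    intro n k m hm
    have h1 : ∀ N, ∃ j ∈ Finset.Ico (p m) (p (m + 1)),
        Nat.pair k j ∈ Finset.Ico (q (nxt N)) (q (nxt N + 1)) → z (Nat.pair k j) ≠ y j := by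
      intro N
      have := hbad N
      push Not at this
      exact this k m hm
    cases n
    exacts [h1 _, h1 _]
  let x : ℕ → Bool := fun i =>
    if ∃ n, i ∈ Finset.Ico (q (L n)) (q (L n + 1)) then z i else !y (Nat.unpair i).2
  have hx1 : ∀ n, ∀ i ∈ Finset.Ico (q (L n)) (q (L n + 1)), x i = z i := fun n i hi =>
    if_pos ⟨n, hi⟩
  have hx2 : ∀ k j, (∀ n, Nat.pair k j ∉ Finset.Ico (q (L n)) (q (L n + 1))) →
      x (Nat.pair k j) ≠ y j := by
    intro k j hj
    have : x (Nat.pair k j) = !y (Nat.unpair (Nat.pair k j)).2 := if_neg (not_exists.2 hj)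
    rw [this, Nat.unpair_pair]
    simp
  have hx : x ∈ blockSet p R y := by
    intro k m hm
    by_cases hmeet : ∃ n, ∃ j ∈ Finset.Ico (p m) (p (m + 1)),
        Nat.pair k j ∈ Finset.Ico (q (L n)) (q (L n + 1))
    · obtain ⟨n, j₀, hj₀, hj₀n⟩ := hmeet
      obtain ⟨j, hj, hjn⟩ := hLbad n k m hm
      refine ⟨j, hj, ?_⟩
      by_cases hin : Nat.pair k j ∈ Finset.Ico (q (L n)) (q (L n + 1))
      · rw [hx1 n _ hin]; exact hjn hin
      refine hx2 k j fun n' hn' => ?_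
      have h1 := Finset.mem_Ico.1 hj₀n
      have h2 := Finset.mem_Ico.1 hn'
      rcases lt_trichotomy n n' with hlt | rfl | hlt
      · have := hb _ k m j₀ j hj₀ hj h1.2
        have := hLb n n' hlt
        omega
      · exact hin hn'
      · have := hb _ k m j j₀ hj hj₀ h2.2
        have := hLb n' n hlt
        omega
    · push Not at hmeet
      have hpm : p m ∈ Finset.Ico (p m) (p (m + 1)) :=
        Finset.mem_Ico.2 ⟨le_rfl, hp (Nat.lt_succ_self m)⟩
      exact ⟨p m, hpm, hx2 k _ fun n => hmeet n _ hpm⟩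
  obtain ⟨n, i, hi, hne⟩ := (hLmono.tendsto_atTop.eventually (h x hx)).exists
  exact hne (hx1 n i hi)

lemma StrictMono.eq_of_mem_Ico {q : ℕ → ℕ} (hq : StrictMono q) {j m n : ℕ}
    (hm : j ∈ Finset.Ico (q m) (q (m + 1))) (hn : j ∈ Finset.Ico (q n) (q (n + 1))) : m = n := by
  rw [Finset.mem_Ico] at hm hn
  have h1 : m < n + 1 := hq.lt_iff_lt.1 (hm.1.trans_lt hn.2)
  have h2 : n < m + 1 := hq.lt_iff_lt.1 (hn.1.trans_lt hm.2)
  omega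

/-- A family of strictly increasing sequences whose block sets have meager union has a common
coarsening. -/
lemma exists_common_intervals {ι : Type} {p : ι → ℕ → ℕ} (hp : ∀ i, StrictMono (p i))
    (y : ι → ℕ → Bool) (h : IsMeagre (⋃ i, blockSet (p i) Ici (y i))) :
    ∃ q : ℕ → ℕ, StrictMono q ∧ ∀ i, ∀ᶠ n in atTop, ∃ m,
      q n ≤ p i m ∧ p i (m + 1) ≤ q (n + 1) := by
  obtain ⟨q, hq, z, hz⟩ := h.exists_blocks
  let g : ℕ → ℕ := fun c => q (c ^ 2 + 1)
  have key : ∀ i, ∀ᶠ c in atTop, ∃ m, c ≤ p i m ∧ p i (m + 1) ≤ g c := by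
    intro i
    have h1 := blockSet_subset_eventually (hp i) hq fun x hx => hz x (mem_iUnion.2 ⟨i, hx⟩)
    have hsq : Tendsto (fun c : ℕ => c ^ 2) atTop atTop := tendsto_pow_atTop two_ne_zero
    filter_upwards [hsq.eventually h1] with c ⟨k, m, hkm, hm⟩
    have hlt : p i m < p i (m + 1) := hp i (Nat.lt_succ_self m)
    have h2 := Finset.mem_Ico.1 (hm (p i m) (Finset.mem_Ico.2 ⟨le_rfl, hlt⟩)).1
    have h3 := Finset.mem_Ico.1 (hm (p i (m + 1) - 1) (Finset.mem_Ico.2 ⟨by omega, by omega⟩)).1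
    have h4 := Nat.right_le_pair k (p i (m + 1) - 1)
    have h5 : c ^ 2 ≤ q (c ^ 2) := hq.le_apply
    have h6 := Nat.pair_lt_max_add_one_sq k (p i m)
    have h7 : m ≤ p i m := (hp i).le_apply
    have h8 : k ≤ m := hkm
    rw [max_eq_right (h8.trans h7)] at h6
    have h9 : c < p i m + 1 := lt_of_pow_lt_pow_left₀ 2 (Nat.zero_le _) (by omega)
    exact ⟨m, by omega, by simp only [g]; omega⟩
  let q' : ℕ → ℕ := fun n => Nat.rec 0 (fun _ c => max (g c) (c + 1)) n
  have hq's : ∀ n, q' (n + 1) = max (g (q' n)) (q' n + 1) := fun n => rfl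
  have hq' : StrictMono q' := strictMono_nat_of_lt_succ fun n => by rw [hq's]; omega
  refine ⟨q', hq', fun i => ?_⟩
  filter_upwards [hq'.tendsto_atTop.eventually (key i)] with n ⟨m, h1, h2⟩
  exact ⟨m, h1, h2.trans (by rw [hq's]; exact le_max_left _ _)⟩

/-- The rows tested by the `n`-th interval. -/
def rowTest (k : ℕ) : Set ℕ := {n | (Nat.unpair n).1 = k}

lemma exists_mem_rowTest (k N : ℕ) : ∃ m ∈ rowTest k, N ≤ m :=
  ⟨Nat.pair k N, by simp [rowTest], Nat.right_le_pair _ _⟩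

/-- If the block sets of sequences `y i` along common intervals have meager union, then the sets of
sequences that eventually differ from `y i` on each interval lie in a common meager set. -/
lemma isMeagre_of_blockSet {ι : Type} {p : ℕ → ℕ} (hp : StrictMono p) (y : ι → ℕ → Bool)
    (h : IsMeagre (⋃ i, blockSet p rowTest (y i))) :
    IsMeagre (⋃ i, {x : ℕ → Bool | ∀ᶠ n in atTop, ∃ j ∈ Finset.Ico (p n) (p (n + 1)),
      x j ≠ y i j}) := by
  classical
  obtain ⟨q, hq, z, hz⟩ := h.exists_blocks
  have hblk : ∀ j, ∃ b, ∀ n, j ∈ Finset.Ico (p n) (p (n + 1)) → b = n := by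
    intro j
    by_cases hj : ∃ n, j ∈ Finset.Ico (p n) (p (n + 1))
    · obtain ⟨n, hn⟩ := hj
      exact ⟨n, fun m hm => hp.eq_of_mem_Ico hn hm⟩
    · exact ⟨0, fun n hn => (hj ⟨n, hn⟩).elim⟩
  choose blk hblk using hblk
  let e : ℕ → ℕ := fun j => Nat.pair (Nat.unpair (blk j)).1 j
  let K : ℕ → Finset ℕ := fun l =>
    (Finset.range (q (l + 1))).filter fun j => e j ∈ Finset.Ico (q l) (q (l + 1))
  have hK : ∀ j, ∀ᶠ l in atTop, j ∉ K l := by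
    intro j
    filter_upwards [eventually_gt_atTop (e j)] with l hl hj
    have h1 := Finset.mem_Ico.1 (Finset.mem_filter.1 hj).2
    have h2 : l ≤ q l := hq.le_apply
    omega
  refine IsMeagre.mono (iUnion_subset fun i x hx => ?_)
    (isMeagre_eventually_ne_on hK fun j => z (e j))
  obtain ⟨M, hM⟩ := eventually_atTop.1 hx
  have h1 := blockSet_subset_eventually hp hq fun w hw => hz w (mem_iUnion.2 ⟨i, hw⟩)
  filter_upwards [h1, eventually_gt_atTop (Nat.pair M (p (M + 1)))] with l ⟨k, n, hkn, hn⟩ hl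
  have hMn : M ≤ n := by
    by_contra hlt
    have h2 := Finset.mem_Ico.1 (hn (p n) (Finset.mem_Ico.2 ⟨le_rfl, hp (Nat.lt_succ_self n)⟩)).1
    have h3 : l ≤ q l := hq.le_apply
    have h4 : k ≤ n := (show (Nat.unpair n).1 = k from hkn) ▸ Nat.unpair_left_le n
    have h5 : Nat.pair k (p n) ≤ Nat.pair M (p (M + 1)) :=
      pair_le_pair (by omega) (hp.monotone (by omega))
    omega
  obtain ⟨j, hj, hne⟩ := hM n hMn
  obtain ⟨h2, h3⟩ := hn j hj
  have he : e j = Nat.pair k j := by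
    simp only [e, hblk j n hj]
    rw [show (Nat.unpair n).1 = k from hkn]
  refine ⟨j, Finset.mem_filter.2 ⟨Finset.mem_range.2 ?_, he ▸ h2⟩, ?_⟩
  · exact (Nat.right_le_pair k j).trans_lt (Finset.mem_Ico.1 h2).2
  · rw [he, h3]
    exact hne

lemma isMeagre_iUnion_of_sigmaC0 {ι : Type} {X : ι → Set HilbertCube} (hX : ∀ i, IsMeagre (X i))
    (h : ∀ B : ι → Set HilbertCube, (∀ i, B i ∈ sigmaC0) → IsMeagre (⋃ i, B i)) :
    IsMeagre (⋃ i, X i) := by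
  have hpre : ∀ {Y : Set HilbertCube}, IsMeagre Y → IsMeagre (binMatrix ⁻¹' Y) := fun hY =>
    hY.preimage_of_fibers continuous_binMatrix binMatrix_surjective dense_rowMixing
      fun x hx w => binMatrix_fiber hx w
  have hblock : ∀ S : ι → Set (ℕ → Bool), (∀ i, binMatrix '' S i ∈ sigmaC0) →
      IsMeagre (⋃ i, S i) := by
    intro S hS
    refine IsMeagre.mono (iUnion_subset fun i x hx => ?_) (hpre (h _ hS))
    exact mem_iUnion.2 ⟨i, x, hx, rfl⟩
  choose p hp y hy using fun i => (hpre (hX i)).exists_blocks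
  obtain ⟨q, hq, hqp⟩ := exists_common_intervals hp y <| hblock _ fun i =>
    image_blockSet_mem_sigmaC0 (hp i) (fun k N => ⟨max k N, le_max_left _ _, le_max_right _ _⟩) _
  have hM := isMeagre_of_blockSet hq y <| hblock _ fun i =>
    image_blockSet_mem_sigmaC0 hq exists_mem_rowTest _
  refine IsMeagre.mono (iUnion_subset fun i => ?_)
    (hM.image_of_fibers continuous_binMatrix binMatrix_surjective dense_rowMixing
      fun x hx w => binMatrix_fiber hx w)
  intro a ha
  obtain ⟨x, rfl⟩ := binMatrix_surjective a
  refine ⟨x, mem_iUnion.2 ⟨i, ?_⟩, rfl⟩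
  obtain ⟨M, hM⟩ := eventually_atTop.1 (hy i x ha)
  filter_upwards [hqp i, eventually_ge_atTop (p i M)] with n ⟨m, h1, h2⟩ hn
  have h3 : n ≤ q n := hq.le_apply
  obtain ⟨j, hj, hne⟩ := hM m ((hp i).le_iff_le.1 (hn.trans (h3.trans h1)))
  rw [Finset.mem_Ico] at hj
  exact ⟨j, Finset.mem_Ico.2 ⟨h1.trans hj.1, hj.2.trans_le h2⟩, hne⟩

/-- `add(σC₀, M) = add(M)`. -/
theorem add_sigmaC0_meager_eq_add_meager :
    addIdeal2 sigmaC0 (MeagerIdeal HilbertCube) = addIdeal (MeagerIdeal HilbertCube) := by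
  have hsingle : ∀ x : HilbertCube, IsMeagre ({x} : Set HilbertCube) := fun x =>
    sigmaC0_subset_meagerIdeal (mem_sigmaC0_of_dense_compl isCompact_singleton fun k => by
      rw [image_singleton]
      exact dense_compl_singleton _)
  have hne : {c | ∃ A : Set (Set HilbertCube), A ⊆ MeagerIdeal HilbertCube ∧
      ⋃₀ A ∉ MeagerIdeal HilbertCube ∧ c = #A}.Nonempty := by
    refine ⟨_, MeagerIdeal HilbertCube, Subset.rfl, fun hmem => ?_, rfl⟩
    refine not_isMeagre_of_isOpen isOpen_univ (univ_nonempty (α := HilbertCube))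
      (IsMeagre.mono (fun x _ => ?_) hmem)
    exact mem_sUnion.2 ⟨{x}, hsingle x, rfl⟩
  obtain ⟨𝒜, h𝒜, hun, hcard⟩ := csInf_mem hne
  obtain ⟨B, hB, hBun⟩ : ∃ B : 𝒜 → Set HilbertCube, (∀ i, B i ∈ sigmaC0) ∧
      ¬ IsMeagre (⋃ i, B i) := by
    by_contra! hcon
    refine hun ?_
    rw [sUnion_eq_iUnion]
    exact isMeagre_iUnion_of_sigmaC0 (fun i => h𝒜 i.2) hcon
  have hmem : #(range B) ∈ {c | ∃ A : Set (Set HilbertCube), A ⊆ sigmaC0 ∧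
      ⋃₀ A ∉ MeagerIdeal HilbertCube ∧ c = #A} :=
    ⟨range B, range_subset_iff.2 hB, by rwa [sUnion_range], rfl⟩
  refine le_antisymm ?_ (csInf_le_csInf' ⟨_, hmem⟩ ?_)
  · exact (csInf_le' hmem).trans (mk_range_le.trans_eq hcard.symm)
  · rintro c ⟨A, hA, hAun, rfl⟩
    exact ⟨A, hA.trans sigmaC0_subset_meagerIdeal, hAun, rfl⟩
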